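/- arXiv:1907.02123 — 11 statements merged into one kernel-verified Lean document; each statement's English description precedes it below -/
import Mathlib

section
/- Assume (H), (E1), (E2), (E3), (C), (PS), and additionally 𝒯(u) = 𝒫(u)^{γ/p} for all u ∈ X. Then for each λ ∈ (0, λ*) there exist u_λ, w_λ ∈ X \ {0} with Φ_λ′(u_λ) = 0 and Φ_λ′(w_λ) = 0 satisfying: if λ ∈ (0, λ₀*) then Φ_λ(u_λ) = inf_{v ∈ X} Φ_λ(v) and Φ_λ(u_λ) < 0 < Φ_λ(w_λ); if λ = λ₀* then Φ_λ(u_λ) = inf_{v ∈ X} Φ_λ(v) = 0 < Φ_λ(w_λ); and if λ ∈ (λ₀*, λ*) then u_λ is a local minimizer of Φ_λ and 0 < Φ_λ(u_λ) < Φ_λ(w_λ). Moreover there exists v ∈ X \ {0} with Φ_{λ*}′(v) = 0 and Φ_{λ*}(v) = ((γ−p)/(pqγ)) · (q−p)^{γ/(γ−p)} · (γ−q)^{−p/(γ−p)} · (λ*)^{−p/(γ−p)}; the families (u_λ) and (w_λ) can be chosen so that Φ_λ(u_λ) → Φ_{λ*}(v) and Φ_λ(w_λ) → Φ_{λ*}(v)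 as λ ↑ λ*; and for every λ > λ* the only u ∈ X with Φ_λ′(u) = 0 is u = 0, so that sup{λ > 0 : Φ_λ has a nonzero critical point} = λ*. -/
open Filter Topology Set

noncomputable def Phi {X : Type*} [NormedAddCommGroup X] [NormedSpace ℝ X]
    (p q γ lam : ℝ) (P T Q : X → ℝ) : X → ℝ :=
  fun u => (1 / p) * P u + (lam / γ) * T u - (1 / q) * Q u

noncomputable def lamZero {X : Type*} [NormedAddCommGroup X] [NormedSpace ℝ X]
    (p q γ : ℝ) (P T Q : X → ℝ) (u : X) : ℝ :=
  (γ / q) * ((q - p) / (γ - p)) * ((p / q) * ((γ - q) / (γ - p))) ^ ((γ - q) / (q - p)) *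
    Q u ^ ((γ - p) / (q - p)) / (T u * P u ^ ((γ - q) / (q - p)))

noncomputable def lamZeroStar {X : Type*} [NormedAddCommGroup X] [NormedSpace ℝ X]
    (p q γ : ℝ) (P T Q : X → ℝ) : ℝ :=
  sSup {l : ℝ | ∃ u : X, u ≠ 0 ∧ l = lamZero p q γ P T Q u}

noncomputable def lamFun {X : Type*} [NormedAddCommGroup X] [NormedSpace ℝ X]
    (p q γ : ℝ) (P T Q : X → ℝ) (u : X) : ℝ :=
  ((q - p) / (γ - p)) * ((γ - q) / (γ - p)) ^ ((γ - q) / (q - p)) *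
    Q u ^ ((γ - p) / (q - p)) / (T u * P u ^ ((γ - q) / (q - p)))

noncomputable def lamStar {X : Type*} [NormedAddCommGroup X] [NormedSpace ℝ X]
    (p q γ : ℝ) (P T Q : X → ℝ) : ℝ :=
  sSup {l : ℝ | ∃ u : X, u ≠ 0 ∧ l = lamFun p q γ P T Q u}

/-- A bounded sequence in a reflexive space has a weakly convergent subsequence. -/
theorem exists_subseq_tendsto_forall_dual {X : Type*} [NormedAddCommGroup X] [NormedSpace ℝ X]
    (hrefl : Function.Surjective ⇑(NormedSpace.inclusionInDoubleDual ℝ X))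
    (u : ℕ → X) (M : ℝ) (hM : ∀ n, ‖u n‖ ≤ M) :
    ∃ (v : X) (φ : ℕ → ℕ), StrictMono φ ∧
      ∀ f : X →L[ℝ] ℝ, Tendsto (fun n => f (u (φ n))) atTop (𝓝 (f v)) := by
  set Y : Submodule ℝ X := (Submodule.span ℝ (range u)).topologicalClosure with hY
  have hYu : ∀ n, u n ∈ Y := fun n =>
    Submodule.le_topologicalClosure _ (Submodule.subset_span (mem_range_self n))
  have hYsep : TopologicalSpace.IsSeparable (Y : Set X) := by
    rw [hY, Submodule.topologicalClosure_coe]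
    exact ((countable_range u).isSeparable.span).closure
  obtain ⟨D, hDc, hD⟩ := hYsep
  have hDne : D.Nonempty := by
    by_contra h
    rw [not_nonempty_iff_eq_empty] at h
    simpa [h] using hD Y.zero_mem
  obtain ⟨y, rfl⟩ := hDc.exists_eq_range hDne
  choose g hg1 hg2 using fun k => exists_dual_vector'' ℝ (y k)
  have hsep : ∀ x ∈ Y, (∀ k, g k x = 0) → x = 0 := by
    intro x hx h0
    rw [← norm_le_zero_iff]
    refine le_of_forall_pos_le_add fun ε hε => ?_
    obtain ⟨_, ⟨k, rfl⟩, hk⟩ := Metric.mem_closure_iff.1 (hD hx) (ε / 2) (half_pos hε)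
    have h1 : ‖y k‖ ≤ ‖y k - x‖ := by
      have h2 : g k (y k - x) = ‖y k‖ := by rw [map_sub, h0, hg2]; simp
      calc ‖y k‖ = g k (y k - x) := h2.symm
        _ ≤ ‖g k (y k - x)‖ := le_abs_self _
        _ ≤ 1 * ‖y k - x‖ := (g k).le_of_opNorm_le (hg1 k) _
        _ = _ := one_mul _
    have h3 : ‖x‖ ≤ ‖y k‖ + ‖y k - x‖ := by
      have := norm_sub_le (y k) (y k - x)
      rwa [sub_sub_cancel] at this
    rw [dist_eq_norm, norm_sub_rev] at hk
    linarith
  have hgM : ∀ n, (fun k => g k (u n)) ∈ Set.pi univ fun _ : ℕ => Metric.closedBall (0 : ℝ) M := by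
    intro n k _
    rw [mem_closedBall_zero_iff]
    calc ‖g k (u n)‖ ≤ 1 * ‖u n‖ := (g k).le_of_opNorm_le (hg1 k) _
      _ ≤ M := by rw [one_mul]; exact hM n
  obtain ⟨a, -, φ, hφ, ha⟩ :=
    (isCompact_univ_pi fun _ : ℕ => isCompact_closedBall (0 : ℝ) M).tendsto_subseq hgM
  rw [tendsto_pi_nhds] at ha
  let J : X → WeakDual ℝ (StrongDual ℝ X) :=
    fun x => StrongDual.toWeakDual (NormedSpace.inclusionInDoubleDual ℝ X x)
  have hJsurj : ∀ z, ∃ x, J x = z := fun z => hrefl (WeakDual.toStrongDual z)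
  have hK := WeakDual.isCompact_closedBall (0 : StrongDual ℝ (StrongDual ℝ X)) M
  have hmem : ∀ n, J (u n) ∈ WeakDual.toStrongDual ⁻¹'
      Metric.closedBall (0 : StrongDual ℝ (StrongDual ℝ X)) M := by
    intro n
    exact (dist_zero_right (NormedSpace.inclusionInDoubleDual ℝ X (u n))).trans_le
      ((NormedSpace.double_dual_bound ℝ X (u n)).trans (hM n))
  have hclus : ∀ x, MapClusterPt (J x) atTop (fun n => J (u (φ n))) →
      x ∈ Y ∧ ∀ k, g k x = a k := by
    intro x hx
    have hev : ∀ f : StrongDual ℝ X, MapClusterPt (f x) atTop (fun n => f (u (φ n))) :=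
      fun f => hx.continuousAt_comp (f := fun z : WeakDual ℝ (StrongDual ℝ X) => z f)
      (WeakDual.eval_continuous f).continuousAt
    refine ⟨?_, fun k => ?_⟩
    · by_contra hxY
      obtain ⟨f, s, hs, hsx⟩ := geometric_hahn_banach_closed_point Y.convex
        (Submodule.isClosed_topologicalClosure _) hxY
      have := (hev f).frequently (lt_mem_nhds hsx)
      obtain ⟨n, hn⟩ := this.exists
      exact absurd (hs _ (hYu (φ n))) (not_lt.2 hn.le)
    · have : (𝓝 (g k x) ⊓ 𝓝 (a k)).NeBot := ClusterPt.mono (hev (g k)) (ha k)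
      exact eq_of_nhds_neBot this
  obtain ⟨z, -, hz⟩ := hK.exists_mapClusterPt (f := atTop) (u := fun n => J (u (φ n)))
    (tendsto_principal.2 (Eventually.of_forall fun n => hmem _))
  obtain ⟨v, rfl⟩ := hJsurj z
  refine ⟨v, φ, hφ, fun f => ?_⟩
  have hlim : Tendsto (fun n => J (u (φ n))) atTop (𝓝 (J v)) := by
    refine hK.tendsto_nhds_of_unique_mapClusterPt (Eventually.of_forall fun n => hmem _) ?_
    intro z' _ hz'
    obtain ⟨w, rfl⟩ := hJsurj z'
    obtain ⟨hv1, hv2⟩ := hclus v hz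
    obtain ⟨hw1, hw2⟩ := hclus w hz'
    have := hsep (w - v) (Y.sub_mem hw1 hv1) fun k => by rw [map_sub, hv2, hw2, sub_self]
    rw [sub_eq_zero.1 this]
  exact ((WeakDual.eval_continuous f).tendsto _).comp hlim

/-- A difference of two negative real powers. -/
noncomputable def rpowDiff (A B α β t : ℝ) : ℝ := A * t ^ (-α) - B * t ^ (-β)

theorem hasDerivAt_rpowDiff (A B α β : ℝ) {t : ℝ} (ht : 0 < t) :
    HasDerivAt (rpowDiff A B α β) (t ^ (-β - 1) * (β * B - α * A * t ^ (β - α))) t := by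
  have h1 := ((Real.hasDerivAt_rpow_const (p := -α) (Or.inl ht.ne')).const_mul A).sub
    ((Real.hasDerivAt_rpow_const (p := -β) (Or.inl ht.ne')).const_mul B)
  refine h1.congr_deriv ?_
  have h2 : t ^ (-α - 1) = t ^ (-β - 1) * t ^ (β - α) := by
    rw [← Real.rpow_add ht]; ring_nf
  rw [h2]; ring

theorem continuousOn_rpowDiff (A B α β : ℝ) : ContinuousOn (rpowDiff A B α β) (Ioi 0) :=
  fun _ ht => (hasDerivAt_rpowDiff A B α β ht).continuousAt.continuousWithinAt

theorem tendsto_rpowDiff_atTop (A B : ℝ) {α β : ℝ} (hα : 0 < α) (hβ : 0 < β) :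
    Tendsto (rpowDiff A B α β) atTop (𝓝 0) := by
  unfold rpowDiff
  simpa using ((tendsto_rpow_neg_atTop hα).const_mul A).sub
    ((tendsto_rpow_neg_atTop hβ).const_mul B)

theorem strictMonoOn_rpowDiff {A B α β s : ℝ} (hA : 0 < A) (hα : 0 < α) (hαβ : α < β)
    (hs : s ^ (β - α) = β * B / (α * A)) : StrictMonoOn (rpowDiff A B α β) (Ioc 0 s) := by
  refine strictMonoOn_of_deriv_pos (convex_Ioc 0 s)
    ((continuousOn_rpowDiff A B α β).mono fun t ht => ht.1) fun t ht => ?_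
  rw [interior_Ioc] at ht
  rw [(hasDerivAt_rpowDiff A B α β ht.1).deriv]
  have h1 : t ^ (β - α) < β * B / (α * A) :=
    hs ▸ Real.rpow_lt_rpow ht.1.le ht.2 (sub_pos.2 hαβ)
  rw [lt_div_iff₀ (by positivity)] at h1
  exact mul_pos (Real.rpow_pos_of_pos ht.1 _) (by linarith)

theorem strictAntiOn_rpowDiff {A B α β s : ℝ} (hA : 0 < A) (hα : 0 < α) (hαβ : α < β)
    (hs0 : 0 < s) (hs : s ^ (β - α) = β * B / (α * A)) :
    StrictAntiOn (rpowDiff A B α β) (Ici s) := by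
  refine strictAntiOn_of_deriv_neg (convex_Ici s)
    ((continuousOn_rpowDiff A B α β).mono fun t ht => hs0.trans_le ht) fun t ht => ?_
  rw [interior_Ici] at ht
  have ht0 : 0 < t := hs0.trans ht
  rw [(hasDerivAt_rpowDiff A B α β ht0).deriv]
  have h1 : β * B / (α * A) < t ^ (β - α) :=
    hs ▸ Real.rpow_lt_rpow hs0.le ht (sub_pos.2 hαβ)
  rw [div_lt_iff₀ (by positivity)] at h1
  exact mul_neg_of_pos_of_neg (Real.rpow_pos_of_pos ht0 _) (by linarith)

theorem rpowDiff_le {A B α β s t : ℝ} (hA : 0 < A) (hα : 0 < α) (hαβ : α < β)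
    (hs0 : 0 < s) (hs : s ^ (β - α) = β * B / (α * A)) (ht : 0 < t) :
    rpowDiff A B α β t ≤ rpowDiff A B α β s := by
  rcases le_total t s with h | h
  · exact (strictMonoOn_rpowDiff hA hα hαβ hs).monotoneOn ⟨ht, h⟩ ⟨hs0, le_rfl⟩ h
  · exact (strictAntiOn_rpowDiff hA hα hαβ hs0 hs).antitoneOn self_mem_Ici h h

theorem rpowDiff_argmax {A B α β s : ℝ} (hA : 0 < A) (hB : 0 < B) (hα : 0 < α) (hαβ : α < β)
    (hs0 : 0 < s) (hs : s ^ (β - α) = β * B / (α * A)) :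
    rpowDiff A B α β s = A * ((β - α) / β) * (A / B * (α / β)) ^ (α / (β - α)) := by
  have hβ : 0 < β := hα.trans hαβ
  have h1 : s ^ (-α) = (A / B * (α / β)) ^ (α / (β - α)) := by
    have : A / B * (α / β) = s ^ (-(β - α)) := by
      rw [Real.rpow_neg hs0.le, hs]; field_simp
    rw [this, ← Real.rpow_mul hs0.le]
    congr 1
    have := (sub_pos.2 hαβ).ne'
    field_simp
  have h2 : s ^ (-α) = s ^ (-β) * s ^ (β - α) := by
    rw [← Real.rpow_add hs0]; ring_nf
  have h3 : B * s ^ (-β) = A * (α / β) * s ^ (-α) := by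
    rw [h2, hs]; field_simp
  rw [rpowDiff, h3, ← h1]
  field_simp

theorem exists_argmax_rpowDiff {A B α β : ℝ} (hA : 0 < A) (hB : 0 < B) (hα : 0 < α)
    (hαβ : α < β) : ∃ s : ℝ, 0 < s ∧ s ^ (β - α) = β * B / (α * A) := by
  have hβ : 0 < β := hα.trans hαβ
  refine ⟨(β * B / (α * A)) ^ (β - α)⁻¹, by positivity, ?_⟩
  exact Real.rpow_inv_rpow (by positivity) (sub_pos.2 hαβ).ne'

theorem exists_rpowDiff_eq_left {A B α β s l : ℝ} (hA : 0 < A) (hB : 0 < B) (hα : 0 < α)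
    (hαβ : α < β) (hs0 : 0 < s) (hs : s ^ (β - α) = β * B / (α * A))
    (hl : 0 < l) (hls : l < rpowDiff A B α β s) :
    ∃ t, 0 < t ∧ t < s ∧ rpowDiff A B α β t = l := by
  set r : ℝ := (B / A) ^ (β - α)⁻¹
  have hr0 : 0 < r := by positivity
  have hr1 : r ^ (β - α) = B / A := Real.rpow_inv_rpow (by positivity) (sub_pos.2 hαβ).ne'
  have hrs : r < s := by
    rw [← Real.rpow_lt_rpow_iff hr0.le hs0.le (sub_pos.2 hαβ), hr1, hs,
      div_lt_div_iff₀ hA (by positivity)]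
    nlinarith [mul_pos hA hB]
  have hGr : rpowDiff A B α β r = 0 := by
    have h2 : r ^ (-α) = r ^ (-β) * r ^ (β - α) := by
      rw [← Real.rpow_add hr0]; ring_nf
    rw [rpowDiff, h2, hr1]; field_simp; ring
  obtain ⟨t, ht, htl⟩ := intermediate_value_Ioo hrs.le
    ((continuousOn_rpowDiff A B α β).mono fun x hx => hr0.trans_le hx.1)
    (show l ∈ Ioo (rpowDiff A B α β r) (rpowDiff A B α β s) from ⟨hGr ▸ hl, hls⟩)
  exact ⟨t, hr0.trans ht.1, ht.2, htl⟩

theorem exists_rpowDiff_eq_right {A B α β s l : ℝ} (hα : 0 < α) (hαβ : α < β) (hs0 : 0 < s)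
    (hl : 0 < l) (hls : l < rpowDiff A B α β s) :
    ∃ t, s < t ∧ rpowDiff A B α β t = l := by
  obtain ⟨r, hrl, hrs⟩ := (((tendsto_rpowDiff_atTop A B hα (hα.trans hαβ)).eventually
    (gt_mem_nhds hl)).and (eventually_gt_atTop s)).exists
  obtain ⟨t, ht, htl⟩ := intermediate_value_Ioo' hrs.le
    ((continuousOn_rpowDiff A B α β).mono fun x hx => hs0.trans_le hx.1)
    (show l ∈ Ioo (rpowDiff A B α β r) (rpowDiff A B α β s) from ⟨hrl, hls⟩)
  exact ⟨t, ht.1, htl⟩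

/-- The two branches of preimages of the levels of `rpowDiff` below its maximum. -/
theorem exists_rpowDiff_branches {A B α β s : ℝ} (hA : 0 < A) (hB : 0 < B) (hα : 0 < α)
    (hαβ : α < β) (hs0 : 0 < s) (hs : s ^ (β - α) = β * B / (α * A)) :
    ∃ r t : ℝ → ℝ,
      (∀ l, 0 < l → l < rpowDiff A B α β s → 0 < r l ∧ r l < s ∧ s < t l ∧
        rpowDiff A B α β (r l) = l ∧ rpowDiff A B α β (t l) = l) ∧
      Tendsto r (𝓝[<] (rpowDiff A B α β s)) (𝓝 s) ∧
      Tendsto t (𝓝[<] (rpowDiff A B α β s)) (𝓝 s) := by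
  have hmono := strictMonoOn_rpowDiff hA hα hαβ hs
  have hanti := strictAntiOn_rpowDiff hA hα hαβ hs0 hs
  have hL : 0 < rpowDiff A B α β s := by
    have := hα.trans hαβ
    have := sub_pos.2 hαβ
    rw [rpowDiff_argmax hA hB hα hαβ hs0 hs]
    positivity
  choose! r hr0 hrs hr using fun l hl hls =>
    exists_rpowDiff_eq_left (l := l) hA hB hα hαβ hs0 hs hl hls
  choose! t hts ht using fun l hl hls =>
    exists_rpowDiff_eq_right (A := A) (B := B) (l := l) hα hαβ hs0 hl hls
  have hev : ∀ a, a < rpowDiff A B α β s →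
      ∀ᶠ l in 𝓝[<] (rpowDiff A B α β s), 0 < l ∧ l < rpowDiff A B α β s ∧ a < l := fun a ha =>
    (eventually_nhdsWithin_of_eventually_nhds (lt_mem_nhds hL)).and
      (eventually_mem_nhdsWithin.and
        (eventually_nhdsWithin_of_eventually_nhds (lt_mem_nhds ha)))
  refine ⟨r, t, fun l hl hls => ⟨hr0 l hl hls, hrs l hl hls, hts l hl hls, hr l hl hls,
    ht l hl hls⟩, tendsto_order.2 ⟨fun a ha => ?_, fun a ha => ?_⟩,
    tendsto_order.2 ⟨fun a ha => ?_, fun a ha => ?_⟩⟩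
  · have hb : max a (s / 2) < s := max_lt ha (by linarith)
    have hb0 : 0 < max a (s / 2) := lt_max_of_lt_right (by linarith)
    filter_upwards [hev _ (hmono ⟨hb0, hb.le⟩ ⟨hs0, le_rfl⟩ hb)] with l ⟨hl, hls, hal⟩
    refine (le_max_left a (s / 2)).trans_lt ?_
    rw [← hr l hl hls] at hal
    exact (hmono.lt_iff_lt ⟨hb0, hb.le⟩ ⟨hr0 l hl hls, (hrs l hl hls).le⟩).1 hal
  · filter_upwards [hev 0 hL] with l ⟨hl, hls, _⟩ using (hrs l hl hls).trans ha
  · filter_upwards [hev 0 hL] with l ⟨hl, hls, _⟩ using ha.trans (hts l hl hls)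
  · filter_upwards [hev _ (hanti self_mem_Ici ha.le ha)] with l ⟨hl, hls, hal⟩
    rw [← ht l hl hls] at hal
    exact (hanti.lt_iff_gt ha.le (hts l hl hls).le).1 hal

/-- The restriction of `Phi` to a ray through a point with `P = 1` and `Q = K`, when
`T = P ^ (γ / p)`. -/
noncomputable def fiberEnergy (p q γ K lam t : ℝ) : ℝ :=
  (1 / p) * t ^ p + (lam / γ) * t ^ γ - (1 / q) * (K * t ^ q)

theorem hasDerivAt_fiberEnergy {p q γ : ℝ} (hp : p ≠ 0) (hq : q ≠ 0) (hγ : γ ≠ 0) (K lam : ℝ)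
    {t : ℝ} (ht : 0 < t) : HasDerivAt (fiberEnergy p q γ K lam)
      (t ^ (γ - 1) * (lam - rpowDiff K 1 (γ - q) (γ - p) t)) t := by
  have h := (((Real.hasDerivAt_rpow_const (p := p) (Or.inl ht.ne')).const_mul (1 / p)).add
    ((Real.hasDerivAt_rpow_const (p := γ) (Or.inl ht.ne')).const_mul (lam / γ))).sub
    (((Real.hasDerivAt_rpow_const (p := q) (Or.inl ht.ne')).const_mul K).const_mul (1 / q))
  refine h.congr_deriv ?_
  have h1 : t ^ (p - 1) = t ^ (γ - 1) * t ^ (-(γ - p)) := by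
    rw [← Real.rpow_add ht]; ring_nf
  have h2 : t ^ (q - 1) = t ^ (γ - 1) * t ^ (-(γ - q)) := by
    rw [← Real.rpow_add ht]; ring_nf
  rw [rpowDiff, h1, h2]
  field_simp
  ring

theorem continuous_fiberEnergy_uncurry {p q γ : ℝ} (hp : 0 < p) (hq : 0 < q) (hγ : 0 < γ)
    (K : ℝ) : Continuous fun x : ℝ × ℝ => fiberEnergy p q γ K x.1 x.2 := by
  have h : ∀ e : ℝ, 0 < e → Continuous fun x : ℝ × ℝ => x.2 ^ e := fun e he =>
    (Real.continuous_rpow_const he.le).comp continuous_snd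
  have h1 := h p hp
  have h2 := h q hq
  have h3 := h γ hγ
  unfold fiberEnergy
  fun_prop

theorem continuous_fiberEnergy {p q γ : ℝ} (hp : 0 < p) (hq : 0 < q) (hγ : 0 < γ)
    (K lam : ℝ) : Continuous (fiberEnergy p q γ K lam) :=
  (continuous_fiberEnergy_uncurry hp hq hγ K).comp (Continuous.prodMk_right lam)

theorem fiberEnergy_zero {p q γ : ℝ} (hp : 0 < p) (hq : 0 < q) (hγ : 0 < γ) (K lam : ℝ) :
    fiberEnergy p q γ K lam 0 = 0 := by
  simp [fiberEnergy, Real.zero_rpow hp.ne', Real.zero_rpow hq.ne', Real.zero_rpow hγ.ne']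

theorem fiberEnergy_eq {p q γ : ℝ} (hγ : γ ≠ 0) (K lam : ℝ) {t : ℝ} (ht : 0 < t) :
    fiberEnergy p q γ K lam t =
      t ^ γ / γ * (lam - rpowDiff (γ / q * K) (γ / p) (γ - q) (γ - p) t) := by
  have h1 : t ^ p = t ^ γ * t ^ (-(γ - p)) := by
    rw [← Real.rpow_add ht]; ring_nf
  have h2 : t ^ q = t ^ γ * t ^ (-(γ - q)) := by
    rw [← Real.rpow_add ht]; ring_nf
  rw [fiberEnergy, rpowDiff, h1, h2]
  field_simp
  ring

theorem fiberEnergy_monotonicity {p q γ K lam r s t : ℝ} (hp : 0 < p) (hpq : p < q)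
    (hqγ : q < γ) (hK : 0 < K) (hs0 : 0 < s)
    (hs : s ^ (γ - p - (γ - q)) = (γ - p) * 1 / ((γ - q) * K))
    (hr0 : 0 < r) (hrs : r < s) (hst : s < t)
    (hr : rpowDiff K 1 (γ - q) (γ - p) r = lam) (ht : rpowDiff K 1 (γ - q) (γ - p) t = lam) :
    StrictMonoOn (fiberEnergy p q γ K lam) (Icc 0 r) ∧
      StrictAntiOn (fiberEnergy p q γ K lam) (Icc r t) ∧
      StrictMonoOn (fiberEnergy p q γ K lam) (Ici t) := by
  have hq : 0 < q := hp.trans hpq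
  have hγ : 0 < γ := hq.trans hqγ
  have hα : 0 < γ - q := sub_pos.2 hqγ
  have hαβ : γ - q < γ - p := by linarith
  have hmono := strictMonoOn_rpowDiff hK hα hαβ hs
  have hanti := strictAntiOn_rpowDiff hK hα hαβ hs0 hs
  have hcont := continuous_fiberEnergy hp hq hγ K lam
  have hderiv : ∀ x, 0 < x → deriv (fiberEnergy p q γ K lam) x =
      x ^ (γ - 1) * (lam - rpowDiff K 1 (γ - q) (γ - p) x) := fun x hx =>
    (hasDerivAt_fiberEnergy hp.ne' hq.ne' hγ.ne' K lam hx).deriv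
  refine ⟨strictMonoOn_of_deriv_pos (convex_Icc 0 r) hcont.continuousOn fun x hx => ?_,
    strictAntiOn_of_deriv_neg (convex_Icc r t) hcont.continuousOn fun x hx => ?_,
    strictMonoOn_of_deriv_pos (convex_Ici t) hcont.continuousOn fun x hx => ?_⟩
  · rw [interior_Icc] at hx
    have := hmono ⟨hx.1, (hx.2.trans hrs).le⟩ ⟨hr0, hrs.le⟩ hx.2
    rw [hderiv x hx.1]
    exact mul_pos (Real.rpow_pos_of_pos hx.1 _) (by linarith)
  · rw [interior_Icc] at hx
    have hx0 := hr0.trans hx.1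
    rw [hderiv x hx0]
    refine mul_neg_of_pos_of_neg (Real.rpow_pos_of_pos hx0 _) ?_
    rcases le_total x s with h | h
    · have := hmono ⟨hr0, hrs.le⟩ ⟨hx0, h⟩ hx.1
      linarith
    · have := hanti h hst.le hx.2
      linarith
  · rw [interior_Ici] at hx
    have hx0 : 0 < x := (hs0.trans hst).trans hx
    have := hanti hst.le (hst.trans hx).le hx
    rw [hderiv x hx0]
    exact mul_pos (Real.rpow_pos_of_pos hx0 _) (by linarith)

theorem fiberEnergy_argmax {p q γ K s : ℝ} (hp : 0 < p) (hpq : p < q) (hqγ : q < γ)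
    (hK : 0 < K) (hs0 : 0 < s)
    (hs : s ^ (γ - p - (γ - q)) = (γ - p) * 1 / ((γ - q) * K)) :
    fiberEnergy p q γ K (rpowDiff K 1 (γ - q) (γ - p) s) s =
      ((γ - p) / (p * q * γ)) * (q - p) ^ (γ / (γ - p)) * (γ - q) ^ (-(p / (γ - p))) *
        rpowDiff K 1 (γ - q) (γ - p) s ^ (-(p / (γ - p))) := by
  have hq : 0 < q := hp.trans hpq
  have hγ : 0 < γ := hq.trans hqγ
  have hα : 0 < γ - q := sub_pos.2 hqγ
  have hβ : 0 < γ - p := by linarith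
  have hd : 0 < q - p := sub_pos.2 hpq
  have hKq : K * s ^ (q - p) = (γ - p) / (γ - q) := by
    rw [show q - p = γ - p - (γ - q) by ring, hs]; field_simp
  set L := rpowDiff K 1 (γ - q) (γ - p) s with hL
  have hLs : L = (q - p) / (γ - q) * s ^ (-(γ - p)) := by
    have h1 : s ^ (-(γ - q)) = s ^ (q - p) * s ^ (-(γ - p)) := by
      rw [← Real.rpow_add hs0]; ring_nf
    rw [hL, rpowDiff, h1, ← mul_assoc, hKq]
    field_simp
    ring
  have h1 : s ^ q = s ^ (q - p) * s ^ p := by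
    rw [← Real.rpow_add hs0]; ring_nf
  have h2 : L * s ^ γ = (q - p) / (γ - q) * s ^ p := by
    rw [hLs, mul_assoc, ← Real.rpow_add hs0]; ring_nf
  have h3 : L ^ (-(p / (γ - p))) = ((q - p) ^ (-(p / (γ - p)))) /
      ((γ - q) ^ (-(p / (γ - p)))) * s ^ p := by
    rw [hLs, Real.mul_rpow (by positivity) (by positivity), Real.div_rpow hd.le hα.le,
      ← Real.rpow_mul hs0.le]
    congr 2
    field_simp
  have h4 : (q - p) ^ (γ / (γ - p)) * (q - p) ^ (-(p / (γ - p))) = q - p := by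
    rw [← Real.rpow_add hd]
    have : γ / (γ - p) + -(p / (γ - p)) = 1 := by field_simp; ring
    rw [this, Real.rpow_one]
  have h5 : 0 < (γ - q) ^ (-(p / (γ - p))) := Real.rpow_pos_of_pos hα _
  calc fiberEnergy p q γ K L s
      = (1 / p) * s ^ p + (L * s ^ γ) / γ - (1 / q) * (K * s ^ (q - p) * s ^ p) := by
        rw [fiberEnergy, h1]; ring
    _ = (γ - p) / (p * q * γ) * (q - p) * s ^ p := by
        rw [h2, hKq]; field_simp; ring
    _ = (γ - p) / (p * q * γ) * ((q - p) ^ (γ / (γ - p)) * (q - p) ^ (-(p / (γ - p)))) *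
          s ^ p := by rw [h4]
    _ = _ := by rw [h3]; field_simp

/-- The quotient `Q / P ^ (q / p)` attains its maximum, at a point where `P = 1`. -/
theorem exists_maximizer_of_homogeneous {X : Type*} [NormedAddCommGroup X] [NormedSpace ℝ X]
    [Nontrivial X] (hrefl : Function.Surjective ⇑(NormedSpace.inclusionInDoubleDual ℝ X))
    {p q : ℝ} (hp : 0 < p) (hpq : p < q) {P Q : X → ℝ}
    (hPh : ∀ t : ℝ, 0 < t → ∀ u : X, P (t • u) = t ^ p * P u)
    (hQh : ∀ t : ℝ, 0 < t → ∀ u : X, Q (t • u) = t ^ q * Q u)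
    (hPpos : ∀ u : X, u ≠ 0 → 0 < P u) (hQpos : ∀ u : X, u ≠ 0 → 0 < Q u)
    {C₁ C₂ : ℝ} (hC₁ : 0 < C₁) (hC₂ : 0 < C₂)
    (hPC : ∀ u : X, C₁ * ‖u‖ ^ p ≤ P u) (hQC : ∀ u : X, Q u ≤ C₂ * ‖u‖ ^ q)
    (hWC : ∀ (u : ℕ → X) (v : X),
      (∀ f : X →L[ℝ] ℝ, Tendsto (fun n => f (u n)) atTop (𝓝 (f v))) →
      P v ≤ liminf (fun n => P (u n)) atTop ∧ Tendsto (fun n => Q (u n)) atTop (𝓝 (Q v))) :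
    ∃ v : X, v ≠ 0 ∧ P v = 1 ∧ ∀ u : X, u ≠ 0 → Q u ≤ Q v * P u ^ (q / p) := by
  have hq : 0 < q := hp.trans hpq
  have hnorm : ∀ u : X, u ≠ 0 → P ((P u ^ (-p⁻¹)) • u) = 1 ∧
      Q ((P u ^ (-p⁻¹)) • u) = Q u / P u ^ (q / p) := by
    intro u hu
    have h := hPpos u hu
    have ht : 0 < P u ^ (-p⁻¹) := Real.rpow_pos_of_pos h _
    rw [hPh _ ht, hQh _ ht, ← Real.rpow_mul h.le, ← Real.rpow_mul h.le]
    constructor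
    · rw [show -p⁻¹ * p = -1 by field_simp, Real.rpow_neg_one, inv_mul_cancel₀ h.ne']
    · rw [show -p⁻¹ * q = -(q / p) by field_simp, Real.rpow_neg h.le]
      field_simp
  have hbound : ∀ u : X, P u = 1 → ‖u‖ ≤ (1 / C₁) ^ p⁻¹ := by
    intro u hu
    have h := hPC u
    rw [hu, mul_comm, ← le_div_iff₀ hC₁] at h
    exact (Real.le_rpow_inv_iff_of_pos (norm_nonneg u) (by positivity) hp).2 h
  set S : Set ℝ := Q '' {u | P u = 1}
  have hSne : S.Nonempty := by
    obtain ⟨u, hu⟩ := exists_ne (0 : X)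
    exact ⟨_, _, (hnorm u hu).1, rfl⟩
  have hSbdd : BddAbove S := by
    refine ⟨C₂ * ((1 / C₁) ^ p⁻¹) ^ q, ?_⟩
    rintro _ ⟨u, hu, rfl⟩
    exact (hQC u).trans (mul_le_mul_of_nonneg_left
      (Real.rpow_le_rpow (norm_nonneg u) (hbound u hu) hq.le) hC₂.le)
  have hP0 : P 0 = 0 := by
    have h := hPh 2 two_pos 0
    rw [smul_zero] at h
    have h2 : (1 : ℝ) < 2 ^ p := Real.one_lt_rpow one_lt_two hp
    have h3 : ((2 : ℝ) ^ p - 1) * P 0 = 0 := by linarith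
    exact (mul_eq_zero.1 h3).resolve_left (by linarith)
  have hQ0 : Q 0 = 0 := by
    have h := hQh 2 two_pos 0
    rw [smul_zero] at h
    have h2 : (1 : ℝ) < 2 ^ q := Real.one_lt_rpow one_lt_two hq
    have h3 : ((2 : ℝ) ^ q - 1) * Q 0 = 0 := by linarith
    exact (mul_eq_zero.1 h3).resolve_left (by linarith)
  have hle : ∀ u : X, u ≠ 0 → Q u / P u ^ (q / p) ≤ sSup S := fun u hu =>
    le_csSup hSbdd ⟨_, (hnorm u hu).1, (hnorm u hu).2⟩
  have hSpos : 0 < sSup S := by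
    obtain ⟨u, hu⟩ := exists_ne (0 : X)
    exact (div_pos (hQpos u hu) (Real.rpow_pos_of_pos (hPpos u hu) _)).trans_le (hle u hu)
  obtain ⟨a, -, ha, haS⟩ := exists_seq_tendsto_sSup hSne hSbdd
  choose u hu1 hua using haS
  obtain ⟨v, φ, hφ, hv⟩ := exists_subseq_tendsto_forall_dual hrefl u _ fun n => hbound _ (hu1 n)
  obtain ⟨hPv, hQv⟩ := hWC (fun n => u (φ n)) v hv
  have hQvS : Q v = sSup S := by
    refine tendsto_nhds_unique hQv ?_
    simp only [hua]
    exact ha.comp hφ.tendsto_atTop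
  have hP1 : ∀ n, P (u (φ n)) = 1 := fun n => hu1 (φ n)
  simp only [hP1, liminf_const] at hPv
  have hv0 : v ≠ 0 := by
    rintro rfl
    linarith
  have hPv0 := hPpos v hv0
  have hPv1 : P v = 1 := by
    refine le_antisymm hPv ?_
    by_contra! h
    have h1 : P v ^ (q / p) < 1 := Real.rpow_lt_one hPv0.le h (by positivity)
    have h2 := hle v hv0
    rw [hQvS, div_le_iff₀ (Real.rpow_pos_of_pos hPv0 _)] at h2
    nlinarith
  refine ⟨v, hv0, hPv1, fun u hu => ?_⟩
  rw [hQvS, ← div_le_iff₀ (Real.rpow_pos_of_pos (hPpos u hu) _)]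
  exact hle u hu

theorem sSup_rayleigh_quotient {X : Type*} [NormedAddCommGroup X] {p q γ c : ℝ}
    (hp : 0 < p) (hpq : p < q) (hqγ : q < γ) (hc : 0 ≤ c) {P T Q : X → ℝ}
    (hPpos : ∀ u : X, u ≠ 0 → 0 < P u) (hQpos : ∀ u : X, u ≠ 0 → 0 < Q u)
    (hT : ∀ u : X, T u = P u ^ (γ / p)) {v : X} (hv : v ≠ 0) (hPv : P v = 1)
    (hmax : ∀ u : X, u ≠ 0 → Q u ≤ Q v * P u ^ (q / p)) :
    sSup {l : ℝ | ∃ u : X, u ≠ 0 ∧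
      l = c * Q u ^ ((γ - p) / (q - p)) / (T u * P u ^ ((γ - q) / (q - p)))} =
      c * Q v ^ ((γ - p) / (q - p)) := by
  have hd : 0 < q - p := sub_pos.2 hpq
  refine IsGreatest.csSup_eq ⟨⟨v, hv, by simp [hT, hPv]⟩, ?_⟩
  rintro _ ⟨u, hu, rfl⟩
  have hPu := hPpos u hu
  have hQv := (hQpos v hv).le
  have h1 : T u * P u ^ ((γ - q) / (q - p)) = (P u ^ (q / p)) ^ ((γ - p) / (q - p)) := by
    rw [hT, ← Real.rpow_add hPu, ← Real.rpow_mul hPu.le]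
    congr 1
    field_simp
    ring
  have h2 : Q u ^ ((γ - p) / (q - p)) ≤
      Q v ^ ((γ - p) / (q - p)) * (P u ^ (q / p)) ^ ((γ - p) / (q - p)) := by
    rw [← Real.mul_rpow hQv (by positivity)]
    exact Real.rpow_le_rpow (hQpos u hu).le (hmax u hu) (div_nonneg (by linarith) hd.le)
  rw [h1, div_le_iff₀ (by positivity), mul_assoc]
  exact mul_le_mul_of_nonneg_left h2 hc

theorem fiberEnergy_le_Phi {X : Type*} [NormedAddCommGroup X] [NormedSpace ℝ X]
    {p q γ lam K : ℝ} (hp : 0 < p) (hq : 0 < q) {P T Q : X → ℝ} {u : X} (hP : 0 ≤ P u)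
    (hT : T u = P u ^ (γ / p)) (hQ : Q u ≤ K * P u ^ (q / p)) :
    fiberEnergy p q γ K lam (P u ^ p⁻¹) ≤ Phi p q γ lam P T Q u := by
  have h : 1 / q * Q u ≤ 1 / q * (K * P u ^ (q / p)) :=
    mul_le_mul_of_nonneg_left hQ (by positivity)
  rw [fiberEnergy, Phi, hT, ← Real.rpow_mul hP, ← Real.rpow_mul hP, ← Real.rpow_mul hP,
    inv_mul_cancel₀ hp.ne', Real.rpow_one, inv_mul_eq_div, inv_mul_eq_div]
  linarith

theorem differentiable_Phi {X : Type*} [NormedAddCommGroup X] [NormedSpace ℝ X]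
    (p q γ lam : ℝ) {P T Q : X → ℝ} (hP : Differentiable ℝ P) (hT : Differentiable ℝ T)
    (hQ : Differentiable ℝ Q) : Differentiable ℝ (Phi p q γ lam P T Q) :=
  ((hP.const_mul _).add (hT.const_mul _)).sub (hQ.const_mul _)

theorem fderiv_Phi_eq_zero_of_fiberEnergy {X : Type*} [NormedAddCommGroup X] [NormedSpace ℝ X]
    {p q γ lam K t : ℝ} {P T Q : X → ℝ} (hPd : Differentiable ℝ P)
    (hΦd : Differentiable ℝ (Phi p q γ lam P T Q))
    (hle : ∀ u, fiberEnergy p q γ K lam (P u ^ p⁻¹) ≤ Phi p q γ lam P T Q u) {x : X}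
    (hPx0 : P x ≠ 0) (hPx : P x ^ p⁻¹ = t)
    (hx : Phi p q γ lam P T Q x = fiberEnergy p q γ K lam t)
    (ht : HasDerivAt (fiberEnergy p q γ K lam) 0 t) :
    fderiv ℝ (Phi p q γ lam P T Q) x = 0 := by
  subst hPx
  have h1 := ht.comp_hasFDerivAt x ((hPd x).hasFDerivAt.rpow_const (p := p⁻¹) (Or.inl hPx0))
  have h2 := (hΦd x).hasFDerivAt.sub h1
  rw [zero_smul, sub_zero] at h2
  refine IsLocalMin.hasFDerivAt_eq_zero (Eventually.of_forall fun u => ?_) h2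
  have := hle u
  simp only [Pi.sub_apply, Function.comp_apply]
  linarith

/-- A critical point of `Phi` satisfies the Nehari identity. -/
theorem nehari_of_fderiv_Phi_eq_zero {X : Type*} [NormedAddCommGroup X] [NormedSpace ℝ X]
    {p q γ lam : ℝ} (hp : p ≠ 0) (hq : q ≠ 0) (hγ : γ ≠ 0) {P T Q : X → ℝ}
    (hΦd : Differentiable ℝ (Phi p q γ lam P T Q))
    (hH : ∀ t : ℝ, 0 < t → ∀ u : X,
      P (t • u) = t ^ p * P u ∧ T (t • u) = t ^ γ * T u ∧ Q (t • u) = t ^ q * Q u)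
    {u : X} (hu : fderiv ℝ (Phi p q γ lam P T Q) u = 0) : P u + lam * T u = Q u := by
  have h1 : HasDerivAt (fun t : ℝ => Phi p q γ lam P T Q (t • u)) 0 1 := by
    have h2 : HasDerivAt (fun t : ℝ => t • u) ((1 : ℝ) • u) 1 := (hasDerivAt_id 1).smul_const u
    have h3 : HasFDerivAt (Phi p q γ lam P T Q) (0 : X →L[ℝ] ℝ) ((1 : ℝ) • u) := by
      rw [one_smul, ← hu]
      exact (hΦd u).hasFDerivAt
    exact h3.comp_hasDerivAt (1 : ℝ) h2
  have hpow : ∀ e : ℝ, HasDerivAt (fun t : ℝ => t ^ e) e 1 := fun e => by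
    simpa using Real.hasDerivAt_rpow_const (x := 1) (p := e) (Or.inl one_ne_zero)
  have h4 := ((((hpow p).mul_const (P u)).const_mul (1 / p)).add
    (((hpow γ).mul_const (T u)).const_mul (lam / γ))).sub
    (((hpow q).mul_const (Q u)).const_mul (1 / q))
  have h5 := h1.congr_of_eventuallyEq (f₁ := _) (EventuallyEq.symm (f := fun t : ℝ =>
    Phi p q γ lam P T Q (t • u)) (g := fun t : ℝ => 1 / p * (t ^ p * P u) +
      lam / γ * (t ^ γ * T u) - 1 / q * (t ^ q * Q u)) (by
        filter_upwards [lt_mem_nhds (zero_lt_one' ℝ)] with t ht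
        obtain ⟨e1, e2, e3⟩ := hH t ht u
        rw [Phi, e1, e2, e3]))
  have h6 := h4.unique h5
  field_simp at h6
  linarith

theorem stmt1
    {X : Type*} [NormedAddCommGroup X] [NormedSpace ℝ X] [CompleteSpace X] [Nontrivial X]
    (hrefl : Function.Surjective ⇑(NormedSpace.inclusionInDoubleDual ℝ X))
    (p q γ : ℝ) (hp : 1 < p) (hpq : p < q) (hqγ : q < γ)
    (P T Q : X → ℝ)
    (hPd : ContDiff ℝ 1 P) (hTd : ContDiff ℝ 1 T) (hQd : ContDiff ℝ 1 Q)
    (hH : ∀ t : ℝ, 0 < t → ∀ u : X,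
      P (t • u) = t ^ p * P u ∧ T (t • u) = t ^ γ * T u ∧ Q (t • u) = t ^ q * Q u)
    (hE1 : ∀ u : X, u ≠ 0 → 0 < P u ∧ 0 < T u ∧ 0 < Q u)
    (C₁ C₂ : ℝ) (hC₁ : 0 < C₁) (hC₂ : 0 < C₂)
    (hE2 : ∀ u : X, C₁ * ‖u‖ ^ p ≤ P u ∧ Q u ≤ C₂ * ‖u‖ ^ q)
    (hE3 : ∃ C : ℝ, 0 < C ∧ ∀ u : X, u ≠ 0 →
      Q u ^ ((γ - p) / (q - p)) ≤ C * (T u * P u ^ ((γ - q) / (q - p))))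
    (hWC : ∀ (u : ℕ → X) (v : X),
      (∀ f : X →L[ℝ] ℝ, Filter.Tendsto (fun n => f (u n)) Filter.atTop (nhds (f v))) →
      P v ≤ Filter.liminf (fun n => P (u n)) Filter.atTop ∧
      T v ≤ Filter.liminf (fun n => T (u n)) Filter.atTop ∧
      Filter.Tendsto (fun n => Q (u n)) Filter.atTop (nhds (Q v)))
    (hPS : ∀ (lam : ℕ → ℝ) (l : ℝ) (u : ℕ → X), 0 < l →
      Filter.Tendsto lam Filter.atTop (nhds l) →
      (∃ M : ℝ, ∀ n, |Phi p q γ (lam n) P T Q (u n)| ≤ M) →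
      Filter.Tendsto (fun n => ‖fderiv ℝ (Phi p q γ (lam n) P T Q) (u n)‖)
        Filter.atTop (nhds 0) →
      ∃ (v : X) (φ : ℕ → ℕ), StrictMono φ ∧
        Filter.Tendsto (fun n => u (φ n)) Filter.atTop (nhds v))
    (hT : ∀ u : X, T u = P u ^ (γ / p)) :
    (∃ uu ww : ℝ → X,
      (∀ lam : ℝ, 0 < lam → lam < lamStar p q γ P T Q →
        uu lam ≠ 0 ∧ ww lam ≠ 0 ∧
        fderiv ℝ (Phi p q γ lam P T Q) (uu lam) = 0 ∧
        fderiv ℝ (Phi p q γ lam P T Q) (ww lam) = 0 ∧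
        (lam < lamZeroStar p q γ P T Q →
          (∀ v : X, Phi p q γ lam P T Q (uu lam) ≤ Phi p q γ lam P T Q v) ∧
          Phi p q γ lam P T Q (uu lam) < 0 ∧ 0 < Phi p q γ lam P T Q (ww lam)) ∧
        (lam = lamZeroStar p q γ P T Q →
          (∀ v : X, Phi p q γ lam P T Q (uu lam) ≤ Phi p q γ lam P T Q v) ∧
          Phi p q γ lam P T Q (uu lam) = 0 ∧ 0 < Phi p q γ lam P T Q (ww lam)) ∧
        (lamZeroStar p q γ P T Q < lam →
          IsLocalMin (Phi p q γ lam P T Q) (uu lam) ∧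
          0 < Phi p q γ lam P T Q (uu lam) ∧ Phi p q γ lam P T Q (uu lam) < Phi p q γ lam P T Q (ww lam))) ∧
      (∃ v : X, v ≠ 0 ∧
        fderiv ℝ (Phi p q γ (lamStar p q γ P T Q) P T Q) v = 0 ∧
        Phi p q γ (lamStar p q γ P T Q) P T Q v =
          ((γ - p) / (p * q * γ)) * (q - p) ^ (γ / (γ - p)) *
            (γ - q) ^ (-(p / (γ - p))) * (lamStar p q γ P T Q) ^ (-(p / (γ - p))) ∧
        Filter.Tendsto (fun lam => Phi p q γ lam P T Q (uu lam))
          (nhdsWithin (lamStar p q γ P T Q) (Set.Iio (lamStar p q γ P T Q))) (nhds (Phi p q γ (lamStar p q γ P T Q) P T Q v)) ∧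
        Filter.Tendsto (fun lam => Phi p q γ lam P T Q (ww lam))
          (nhdsWithin (lamStar p q γ P T Q) (Set.Iio (lamStar p q γ P T Q))) (nhds (Phi p q γ (lamStar p q γ P T Q) P T Q v)))) ∧
    (∀ lam : ℝ, lamStar p q γ P T Q < lam → ∀ u : X, fderiv ℝ (Phi p q γ lam P T Q) u = 0 → u = 0) ∧
    sSup {lam : ℝ | 0 < lam ∧ ∃ u : X, u ≠ 0 ∧ fderiv ℝ (Phi p q γ lam P T Q) u = 0} = lamStar p q γ P T Q := by
  have hp0 : 0 < p := one_pos.trans hp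
  have hq0 : 0 < q := hp0.trans hpq
  have hγ0 : 0 < γ := hq0.trans hqγ
  have hα : 0 < γ - q := sub_pos.2 hqγ
  have hαβ : γ - q < γ - p := by linarith
  have hβ : 0 < γ - p := hα.trans hαβ
  have hd : 0 < q - p := sub_pos.2 hpq
  have hPdiff : Differentiable ℝ P := hPd.differentiable one_ne_zero
  have hΦd : ∀ lam, Differentiable ℝ (Phi p q γ lam P T Q) := fun lam =>
    differentiable_Phi p q γ lam hPdiff (hTd.differentiable one_ne_zero)
      (hQd.differentiable one_ne_zero)
  have hPpos : ∀ u : X, u ≠ 0 → 0 < P u := fun u hu => (hE1 u hu).1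
  have hQpos : ∀ u : X, u ≠ 0 → 0 < Q u := fun u hu => (hE1 u hu).2.2
  obtain ⟨v, hv0, hPv, hmax⟩ := exists_maximizer_of_homogeneous hrefl hp0 hpq
    (fun t ht u => (hH t ht u).1) (fun t ht u => (hH t ht u).2.2) hPpos hQpos hC₁ hC₂
    (fun u => (hE2 u).1) (fun u => (hE2 u).2)
    (fun u v h => ⟨(hWC u v h).1, (hWC u v h).2.2⟩)
  obtain ⟨K, hKdef⟩ : ∃ K, Q v = K := ⟨_, rfl⟩
  have hK : 0 < K := hKdef ▸ hQpos v hv0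
  have hP0 : ∀ u, 0 ≤ P u := fun u =>
    (mul_nonneg hC₁.le (Real.rpow_nonneg (norm_nonneg u) p)).trans (hE2 u).1
  have hQ_le : ∀ u, Q u ≤ K * P u ^ (q / p) := by
    intro u
    rcases eq_or_ne u 0 with rfl | hu
    · have h := (hE2 0).2
      rw [norm_zero, Real.zero_rpow hq0.ne', mul_zero] at h
      exact h.trans (mul_nonneg hK.le (Real.rpow_nonneg (hP0 0) _))
    · exact hKdef ▸ hmax u hu
  have hle : ∀ lam u, fiberEnergy p q γ K lam (P u ^ p⁻¹) ≤ Phi p q γ lam P T Q u :=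
    fun lam u => fiberEnergy_le_Phi hp0 hq0 (hP0 u) (hT u) (hQ_le u)
  have hray : ∀ lam t, 0 < t → Phi p q γ lam P T Q (t • v) = fiberEnergy p q γ K lam t := by
    intro lam t ht
    obtain ⟨e1, e2, e3⟩ := hH t ht v
    rw [Phi, e1, e2, e3, hT v, hPv, hKdef, Real.one_rpow, fiberEnergy]
    ring
  have hPray : ∀ t, 0 < t → P (t • v) ^ p⁻¹ = t := fun t ht => by
    rw [(hH t ht v).1, hPv, mul_one, Real.rpow_rpow_inv ht.le hp0.ne']
  have hray0 : ∀ t : ℝ, 0 < t → t • v ≠ 0 := fun t ht => smul_ne_zero ht.ne' hv0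
  have hcrit : ∀ t, 0 < t → ∀ lam, rpowDiff K 1 (γ - q) (γ - p) t = lam →
      fderiv ℝ (Phi p q γ lam P T Q) (t • v) = 0 := by
    intro t ht lam hlam
    refine fderiv_Phi_eq_zero_of_fiberEnergy hPdiff (hΦd lam) (hle lam)
      (hPpos _ (hray0 t ht)).ne' (hPray t ht) (hray lam t ht) ?_
    refine (hasDerivAt_fiberEnergy hp0.ne' hq0.ne' hγ0.ne' K lam ht).congr_deriv ?_
    rw [hlam, sub_self, mul_zero]
  obtain ⟨s, hs0, hs⟩ := exists_argmax_rpowDiff hK one_pos hα hαβ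
  have hdd : γ - p - (γ - q) = q - p := by ring
  have hexp : ∀ x y : ℝ, 0 ≤ x → 0 ≤ y →
      K * x * (K * y) ^ ((γ - q) / (q - p)) =
        x * y ^ ((γ - q) / (q - p)) * K ^ ((γ - p) / (q - p)) := by
    intro x y hx hy
    have : (γ - p) / (q - p) = 1 + (γ - q) / (q - p) := by field_simp; ring
    rw [this, Real.rpow_add hK, Real.rpow_one, Real.mul_rpow hK.le hy]
    ring
  have hstar : lamStar p q γ P T Q = rpowDiff K 1 (γ - q) (γ - p) s := by
    have h := sSup_rayleigh_quotient hp0 hpq hqγ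
      (c := ((q - p) / (γ - p)) * ((γ - q) / (γ - p)) ^ ((γ - q) / (q - p)))
      (by positivity) hPpos hQpos hT hv0 hPv hmax
    rw [rpowDiff_argmax hK one_pos hα hαβ hs0 hs, hdd, div_one,
      hexp _ _ (by positivity) (by positivity), ← hKdef, ← h]
    rfl
  have hA' : 0 < γ / q * K := by positivity
  have hB' : 0 < γ / p := by positivity
  obtain ⟨s', hs0', hs'⟩ := exists_argmax_rpowDiff hA' hB' hα hαβ
  have hzero : lamZeroStar p q γ P T Q =
      rpowDiff (γ / q * K) (γ / p) (γ - q) (γ - p) s' := by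
    have h := sSup_rayleigh_quotient hp0 hpq hqγ
      (c := (γ / q) * ((q - p) / (γ - p)) *
        ((p / q) * ((γ - q) / (γ - p))) ^ ((γ - q) / (q - p)))
      (by positivity) hPpos hQpos hT hv0 hPv hmax
    rw [rpowDiff_argmax hA' hB' hα hαβ hs0' hs', hdd,
      show γ / q * K * ((q - p) / (γ - p)) = K * (γ / q * ((q - p) / (γ - p))) by ring,
      show γ / q * K / (γ / p) * ((γ - q) / (γ - p)) = K * (p / q * ((γ - q) / (γ - p))) by
        field_simp,
      hexp _ _ (by positivity) (by positivity), ← hKdef, ← h]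
    rfl
  have hLpos : 0 < lamStar p q γ P T Q := by
    rw [hstar, rpowDiff_argmax hK one_pos hα hαβ hs0 hs, hdd]
    positivity
  have hnonex : ∀ lam : ℝ, lamStar p q γ P T Q < lam → ∀ u : X,
      fderiv ℝ (Phi p q γ lam P T Q) u = 0 → u = 0 := by
    intro lam hlam u hu
    by_contra hu0
    have hN := nehari_of_fderiv_Phi_eq_zero hp0.ne' hq0.ne' hγ0.ne' (hΦd lam) hH hu
    have hx : 0 < P u ^ p⁻¹ := Real.rpow_pos_of_pos (hPpos u hu0) _
    have hG := rpowDiff_le hK hα hαβ hs0 hs hx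
    rw [← hstar] at hG
    have hTx : T u = (P u ^ p⁻¹) ^ γ := by
      rw [hT, ← Real.rpow_mul (hP0 u), inv_mul_eq_div]
    have hQx : Q u ≤ K * (P u ^ p⁻¹) ^ q := by
      rw [← Real.rpow_mul (hP0 u), inv_mul_eq_div]
      exact hQ_le u
    have hPx : P u = (P u ^ p⁻¹) ^ p := (Real.rpow_inv_rpow (hP0 u) hp0.ne').symm
    generalize P u ^ p⁻¹ = x at *
    have h1 : x ^ p = x ^ γ * x ^ (-(γ - p)) := by
      rw [← Real.rpow_add hx]; ring_nf
    have h2 : x ^ q = x ^ γ * x ^ (-(γ - q)) := by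
      rw [← Real.rpow_add hx]; ring_nf
    have h3 : x ^ γ * lam ≤ x ^ γ * rpowDiff K 1 (γ - q) (γ - p) x := by
      rw [rpowDiff, mul_sub, one_mul, ← h1, mul_left_comm, ← h2, ← hPx, mul_comm, ← hTx]
      linarith
    have h4 := le_of_mul_le_mul_left h3 (Real.rpow_pos_of_pos hx _)
    linarith
  obtain ⟨r, t, hrt, hr_lim, ht_lim⟩ := exists_rpowDiff_branches hK one_pos hα hαβ hs0 hs
  rw [← hstar] at hrt hr_lim ht_lim
  have henergy : ∀ x : ℝ → ℝ, (∀ l, 0 < l → l < lamStar p q γ P T Q → 0 < x l) →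
      Tendsto x (𝓝[<] (lamStar p q γ P T Q)) (𝓝 s) →
      Tendsto (fun lam => Phi p q γ lam P T Q (x lam • v))
        (𝓝[<] (lamStar p q γ P T Q))
        (𝓝 (Phi p q γ (lamStar p q γ P T Q) P T Q (s • v))) := by
    intro x hx hlim
    have h1 : Tendsto (fun lam => fiberEnergy p q γ K lam (x lam))
        (𝓝[<] (lamStar p q γ P T Q))
        (𝓝 (fiberEnergy p q γ K (lamStar p q γ P T Q) s)) :=
      ((continuous_fiberEnergy_uncurry hp0 hq0 hγ0 K).tendsto _).comp
        ((tendsto_nhdsWithin_of_tendsto_nhds tendsto_id).prodMk_nhds hlim)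
    rw [hray _ _ hs0]
    refine h1.congr' ?_
    filter_upwards [eventually_nhdsWithin_of_eventually_nhds (lt_mem_nhds hLpos),
      eventually_mem_nhdsWithin] with lam h0 hlt
    exact (hray lam _ (hx lam h0 hlt)).symm
  refine ⟨⟨fun lam => t lam • v, fun lam => r lam • v, fun lam hlam hlamL => ?_,
    s • v, hray0 s hs0, hcrit s hs0 _ hstar.symm, ?_, henergy t ?_ ht_lim,
    henergy r (fun l h0 hl => (hrt l h0 hl).1) hr_lim⟩, hnonex, ?_⟩
  · obtain ⟨hr0, hrs, hst, hr, ht⟩ := hrt lam hlam hlamL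
    have ht0 : 0 < t lam := hs0.trans hst
    obtain ⟨hinc, hdec, hinc'⟩ :=
      fiberEnergy_monotonicity hp0 hpq hqγ hK hs0 hs hr0 hrs hst hr ht
    have hE0 := fiberEnergy_zero hp0 hq0 hγ0 K lam
    have hnn : ∀ x, 0 ≤ x → x ≤ r lam → 0 ≤ fiberEnergy p q γ K lam x := fun x hx0 hxr =>
      hE0 ▸ hinc.monotoneOn ⟨le_rfl, hr0.le⟩ ⟨hx0, hxr⟩ hx0
    have hEr : 0 < fiberEnergy p q γ K lam (r lam) :=
      hE0 ▸ hinc ⟨le_rfl, hr0.le⟩ ⟨hr0.le, le_rfl⟩ hr0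
    have hrt' : r lam < t lam := hrs.trans hst
    have hErt : fiberEnergy p q γ K lam (t lam) < fiberEnergy p q γ K lam (r lam) :=
      hdec ⟨le_rfl, hrt'.le⟩ ⟨hrt'.le, le_rfl⟩ hrt'
    have hmin : ∀ x, r lam ≤ x →
        fiberEnergy p q γ K lam (t lam) ≤ fiberEnergy p q γ K lam x := by
      intro x hx
      rcases le_total x (t lam) with h | h
      · exact hdec.antitoneOn ⟨hx, h⟩ ⟨hrt'.le, le_rfl⟩ h
      · exact hinc'.monotoneOn self_mem_Ici h h
    have hglob : fiberEnergy p q γ K lam (t lam) ≤ 0 → ∀ u : X,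
        fiberEnergy p q γ K lam (t lam) ≤ Phi p q γ lam P T Q u := by
      intro h u
      refine le_trans ?_ (hle lam u)
      rcases le_total (P u ^ p⁻¹) (r lam) with hx | hx
      · exact h.trans (hnn _ (Real.rpow_nonneg (hP0 u) _) hx)
      · exact hmin _ hx
    have hnonpos : ∀ x, 0 < x → fiberEnergy p q γ K lam x ≤ 0 →
        fiberEnergy p q γ K lam (t lam) ≤ fiberEnergy p q γ K lam x := by
      intro x hx h
      refine hmin x (le_of_not_gt fun hlt => ?_)
      have := hinc ⟨le_rfl, hr0.le⟩ ⟨hx.le, hlt.le⟩ hx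
      linarith
    have hsign : fiberEnergy p q γ K lam s' =
        s' ^ γ / γ * (lam - lamZeroStar p q γ P T Q) :=
      hzero ▸ fiberEnergy_eq hγ0.ne' K lam hs0'
    have hsign_t : t lam ^ γ / γ * (lam - lamZeroStar p q γ P T Q) ≤
        fiberEnergy p q γ K lam (t lam) := by
      rw [fiberEnergy_eq hγ0.ne' K lam ht0, hzero]
      exact mul_le_mul_of_nonneg_left
        (sub_le_sub_left (rpowDiff_le hA' hα hαβ hs0' hs' ht0) _) (by positivity)
    have hs'pos : 0 < s' ^ γ / γ := by positivity
    have htpos : 0 < t lam ^ γ / γ := by positivity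
    rw [hray lam _ ht0, hray lam _ hr0]
    refine ⟨hray0 _ ht0, hray0 _ hr0, hcrit _ ht0 _ ht, hcrit _ hr0 _ hr, fun h => ?_,
      fun h => ?_, fun h => ?_⟩
    · have h1 : fiberEnergy p q γ K lam s' < 0 :=
        hsign ▸ mul_neg_of_pos_of_neg hs'pos (sub_neg.2 h)
      have h2 := (hnonpos s' hs0' h1.le).trans_lt h1
      exact ⟨hglob h2.le, h2, hEr⟩
    · rw [h, sub_self, mul_zero, ← h] at hsign hsign_t
      have h2 : fiberEnergy p q γ K lam (t lam) = 0 :=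
        le_antisymm ((hnonpos s' hs0' hsign.le).trans hsign.le) hsign_t
      exact ⟨hglob h2.le, h2, hEr⟩
    · refine ⟨?_, (mul_pos htpos (sub_pos.2 h)).trans_le hsign_t, hErt⟩
      have hcont : Continuous fun u => P u ^ p⁻¹ :=
        hPd.continuous.rpow_const fun _ => Or.inr (inv_nonneg.2 hp0.le)
      have hev : ∀ᶠ u in 𝓝 (t lam • v), r lam < P u ^ p⁻¹ :=
        hcont.continuousAt.eventually (lt_mem_nhds (hrt'.trans_eq (hPray _ ht0).symm))
      filter_upwards [hev] with u hu
      rw [hray lam _ ht0]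
      exact (hmin _ hu.le).trans (hle lam u)
  · rw [hray _ _ hs0, hstar]
    exact fiberEnergy_argmax hp0 hpq hqγ hK hs0 hs
  · exact fun l h0 hl => hs0.trans (hrt l h0 hl).2.2.1
  · refine IsGreatest.csSup_eq ⟨⟨hLpos, s • v, hray0 s hs0, hcrit s hs0 _ hstar.symm⟩, ?_⟩
    rintro lam ⟨-, u, hu0, hu⟩
    exact le_of_not_gt fun h => hu0 (hnonex lam h u hu)
end

section
/- Assume (H), (E1) and (E3). If λ > λ* and u ∈ X satisfies Φ_λ′(u) = 0, then u = 0. -/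
open Filter Topology Set

theorem fderiv_apply_self_of_rpow_homogeneous {X : Type*} [NormedAddCommGroup X]
    [NormedSpace ℝ X] {F : X → ℝ} {r : ℝ} {u : X} (hF : DifferentiableAt ℝ F u)
    (hom : ∀ t : ℝ, 0 < t → F (t • u) = t ^ r * F u) : fderiv ℝ F u u = r * F u := by
  have h₁ : HasDerivAt (fun t : ℝ => F (t • u)) (fderiv ℝ F u u) 1 := by
    have hs : HasDerivAt (fun t : ℝ => t • u) u 1 := by
      simpa using (hasDerivAt_id (1 : ℝ)).smul_const u
    have hF' : HasFDerivAt F (fderiv ℝ F u) ((1 : ℝ) • u) := by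
      simpa using hF.hasFDerivAt
    exact hF'.comp_hasDerivAt 1 hs
  have h₂ : HasDerivAt (fun t : ℝ => t ^ r * F u) (r * F u) 1 := by
    simpa using (Real.hasDerivAt_rpow_const (x := 1) (p := r) (Or.inl one_ne_zero)).mul_const (F u)
  refine h₁.unique (h₂.congr_of_eventuallyEq ?_)
  filter_upwards [lt_mem_nhds one_pos] with t ht using hom t ht

theorem sub_le_rpow_div_rpow {a x y : ℝ} (ha : 1 < a) (hx : 0 < x) (hy : 0 < y) :
    y - x ≤ 1 / a * ((a - 1) / a) ^ (a - 1) * y ^ a / x ^ (a - 1) := by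
  have ha₀ : 0 < a := one_pos.trans ha
  have ha₁ : 0 < a - 1 := sub_pos.2 ha
  set r := (a - 1) / a with hr
  have hr₀ : 0 < r := div_pos ha₁ ha₀
  have hb : 0 < r * y / x := by positivity
  have key := one_add_mul_self_le_rpow_one_add (s := r * y / x - 1) (by linarith) ha.le
  rw [add_sub_cancel, Real.div_rpow (by positivity) hx.le, Real.mul_rpow hr₀.le hy.le] at key
  have hsplit : ∀ z : ℝ, 0 < z → z ^ a = z ^ (a - 1) * z := fun z hz => by
    rw [← Real.rpow_add_one hz.ne', sub_add_cancel]
  rw [hsplit r hr₀, hsplit x hx] at key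
  have hx' : 0 < x ^ (a - 1) := Real.rpow_pos_of_pos hx _
  calc y - x = x / (a - 1) * (1 + a * (r * y / x - 1)) := by
        rw [hr]; field_simp; ring
    _ ≤ x / (a - 1) * (r ^ (a - 1) * r * y ^ a / (x ^ (a - 1) * x)) := by gcongr
    _ = 1 / a * r ^ (a - 1) * y ^ a / x ^ (a - 1) := by
        generalize r ^ (a - 1) = R
        rw [hr]; field_simp

theorem stmt3
    {X : Type*} [NormedAddCommGroup X] [NormedSpace ℝ X] [CompleteSpace X]
    (hrefl : Function.Surjective ⇑(NormedSpace.inclusionInDoubleDual ℝ X))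
    (p q γ : ℝ) (hp : 1 < p) (hpq : p < q) (hqγ : q < γ)
    (P T Q : X → ℝ)
    (hPd : ContDiff ℝ 1 P) (hTd : ContDiff ℝ 1 T) (hQd : ContDiff ℝ 1 Q)
    (hH : ∀ t : ℝ, 0 < t → ∀ u : X,
      P (t • u) = t ^ p * P u ∧ T (t • u) = t ^ γ * T u ∧ Q (t • u) = t ^ q * Q u)
    (hE1 : ∀ u : X, u ≠ 0 → 0 < P u ∧ 0 < T u ∧ 0 < Q u)
    (hE3 : ∃ C : ℝ, 0 < C ∧ ∀ u : X, u ≠ 0 →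
      Q u ^ ((γ - p) / (q - p)) ≤ C * (T u * P u ^ ((γ - q) / (q - p))))
 :
    ∀ lam : ℝ, lamStar p q γ P T Q < lam → ∀ u : X, fderiv ℝ (Phi p q γ lam P T Q) u = 0 → u = 0 := by
  intro lam hlam u hu
  by_contra hne
  obtain ⟨hPu, hTu, hQu⟩ := hE1 u hne
  have hp₀ : 0 < p := one_pos.trans hp
  have hq₀ : 0 < q := hp₀.trans hpq
  have hγ₀ : 0 < γ := hq₀.trans hqγ
  have hqp : 0 < q - p := sub_pos.2 hpq
  have hγq : 0 < γ - q := sub_pos.2 hqγ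
  have hγp : 0 < γ - p := by linarith
  have dP := hPd.differentiable one_ne_zero u
  have dT := hTd.differentiable one_ne_zero u
  have dQ := hQd.differentiable one_ne_zero u
  have hder : HasFDerivAt (Phi p q γ lam P T Q)
      ((1 / p) • fderiv ℝ P u + (lam / γ) • fderiv ℝ T u - (1 / q) • fderiv ℝ Q u) u :=
    ((dP.hasFDerivAt.const_mul _).add (dT.hasFDerivAt.const_mul _)).sub
      (dQ.hasFDerivAt.const_mul _)
  have hcrit : P u + lam * T u - Q u = 0 := by
    have h := DFunLike.congr_fun (hder.fderiv.symm.trans hu) u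
    simp only [sub_apply, add_apply,
      smul_apply, zero_apply, smul_eq_mul,
      fderiv_apply_self_of_rpow_homogeneous dP fun t ht => (hH t ht u).1,
      fderiv_apply_self_of_rpow_homogeneous dT fun t ht => (hH t ht u).2.1,
      fderiv_apply_self_of_rpow_homogeneous dQ fun t ht => (hH t ht u).2.2] at h
    field_simp at h
    linarith
  have hbdd : BddAbove {l : ℝ | ∃ u : X, u ≠ 0 ∧ l = lamFun p q γ P T Q u} := by
    obtain ⟨C, -, hC⟩ := hE3
    refine ⟨(q - p) / (γ - p) * ((γ - q) / (γ - p)) ^ ((γ - q) / (q - p)) * C, ?_⟩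
    rintro _ ⟨v, hv, rfl⟩
    obtain ⟨hPv, hTv, -⟩ := hE1 v hv
    rw [lamFun, div_le_iff₀ (by positivity), mul_assoc _ C]
    exact mul_le_mul_of_nonneg_left (hC v hv) (by positivity)
  have hlt : lamFun p q γ P T Q u < lam := (le_csSup hbdd ⟨u, hne, rfl⟩).trans_lt hlam
  have hle := sub_le_rpow_div_rpow ((one_lt_div hqp).2 (by linarith : q - p < γ - p)) hPu hQu
  have e₁ : (γ - p) / (q - p) - 1 = (γ - q) / (q - p) := by field_simp; ring
  have e₂ : (γ - q) / (q - p) / ((γ - p) / (q - p)) = (γ - q) / (γ - p) := by field_simp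
  rw [e₁, e₂, one_div_div] at hle
  have hmul : lamFun p q γ P T Q u * T u < lam * T u := mul_lt_mul_of_pos_right hlt hTu
  rw [lamFun, mul_comm (T u), ← div_div, div_mul_cancel₀ _ hTu.ne'] at hmul
  linarith
end

section
/- Exactly one of the following three alternatives holds: (I) φ_λ has exactly two critical points 0 < t⁻ < t⁺ in (0,∞), with φ_λ″(t⁻) < 0 (so t⁻ is a local maximum point) and φ_λ″(t⁺) > 0 (so t⁺ is a local minimum point); (II) φ_λ has exactly one critical point t₀ in (0,∞), at which φ_λ″(t₀) = 0, and φ_λ is nondecreasing on (0,∞); (III) φ_λ′(t) > 0 for all t > 0, so φ_λ is strictly increasing and has no critical point in (0,∞). -/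
open Filter Topology Set

noncomputable def phiF (p q γ a b c lam : ℝ) : ℝ → ℝ := fun t =>
  (a / p) * t ^ p + (lam * b / γ) * t ^ γ - (c / q) * t ^ q

def AltI (φ : ℝ → ℝ) : Prop :=
  ∃ t1 t2 : ℝ, 0 < t1 ∧ t1 < t2 ∧
    deriv φ t1 = 0 ∧ deriv φ t2 = 0 ∧
    (∀ t : ℝ, 0 < t → deriv φ t = 0 → t = t1 ∨ t = t2) ∧
    deriv (deriv φ) t1 < 0 ∧ IsLocalMax φ t1 ∧
    0 < deriv (deriv φ) t2 ∧ IsLocalMin φ t2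

def AltII (φ : ℝ → ℝ) : Prop :=
  ∃ t0 : ℝ, 0 < t0 ∧ deriv φ t0 = 0 ∧
    (∀ t : ℝ, 0 < t → deriv φ t = 0 → t = t0) ∧
    deriv (deriv φ) t0 = 0 ∧ MonotoneOn φ (Set.Ioi 0)

def AltIII (φ : ℝ → ℝ) : Prop :=
  (∀ t : ℝ, 0 < t → 0 < deriv φ t) ∧ StrictMonoOn φ (Set.Ioi 0) ∧
    ∀ t : ℝ, 0 < t → deriv φ t ≠ 0

theorem AltI.not_altII {φ : ℝ → ℝ} (h : AltI φ) : ¬AltII φ := by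
  rintro ⟨t0, -, -, huniq, -⟩
  obtain ⟨t1, t2, ht1, ht12, hd1, hd2, -⟩ := h
  exact ht12.ne ((huniq t1 ht1 hd1).trans (huniq t2 (ht1.trans ht12) hd2).symm)

theorem AltI.not_altIII {φ : ℝ → ℝ} (h : AltI φ) : ¬AltIII φ := by
  rintro ⟨-, -, hne⟩
  obtain ⟨t1, t2, ht1, -, hd1, -⟩ := h
  exact hne t1 ht1 hd1

theorem AltII.not_altIII {φ : ℝ → ℝ} (h : AltII φ) : ¬AltIII φ := by
  rintro ⟨-, -, hne⟩
  obtain ⟨t0, ht0, hd0, -⟩ := h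
  exact hne t0 ht0 hd0

theorem exists_pos_rpow_eq {d K : ℝ} (hd : d ≠ 0) (hK : 0 < K) : ∃ T : ℝ, 0 < T ∧ T ^ d = K :=
  ⟨K ^ d⁻¹, Real.rpow_pos_of_pos hK _, Real.rpow_inv_rpow hK.le hd⟩

/-- The function `t ↦ a + B t ^ r - c t ^ s`. -/
noncomputable def trinomial (r s a B c : ℝ) : ℝ → ℝ := fun t => a + B * t ^ r - c * t ^ s

section Trinomial

variable {r s a B c : ℝ}

theorem hasDerivAt_trinomial {t : ℝ} (ht : 0 < t) :
    HasDerivAt (trinomial r s a B c)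
      (B * (r * t ^ (r - 1)) - c * (s * t ^ (s - 1))) t := by
  have h := (((Real.hasDerivAt_rpow_const (p := r) (Or.inl ht.ne')).const_mul B).const_add a).sub
    ((Real.hasDerivAt_rpow_const (p := s) (Or.inl ht.ne')).const_mul c)
  exact h

theorem continuous_trinomial (hs : 0 ≤ s) (hr : 0 ≤ r) : Continuous (trinomial r s a B c) := by
  unfold trinomial
  exact (continuous_const.add (continuous_const.mul (Real.continuous_rpow_const hr))).sub
    (continuous_const.mul (Real.continuous_rpow_const hs))

theorem deriv_trinomial_eq_mul (hB : B ≠ 0) (hr : r ≠ 0) {T t : ℝ}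
    (hT : T ^ (r - s) = c * s / (B * r)) (ht : 0 < t) :
    deriv (trinomial r s a B c) t = B * r * t ^ (s - 1) * (t ^ (r - s) - T ^ (r - s)) := by
  rw [(hasDerivAt_trinomial ht).deriv, hT, show r - 1 = (s - 1) + (r - s) by ring,
    Real.rpow_add ht]
  field_simp

theorem deriv_trinomial_neg (hB : 0 < B) (hr : 0 < r) (hsr : s < r) {T t : ℝ}
    (hT : T ^ (r - s) = c * s / (B * r)) (ht : 0 < t) (htT : t < T) :
    deriv (trinomial r s a B c) t < 0 := by
  rw [deriv_trinomial_eq_mul hB.ne' hr.ne' hT ht]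
  have := Real.rpow_lt_rpow ht.le htT (sub_pos.2 hsr)
  exact mul_neg_of_pos_of_neg (by positivity) (sub_neg.2 this)

theorem deriv_trinomial_pos (hB : 0 < B) (hr : 0 < r) (hsr : s < r) {T t : ℝ}
    (hT : T ^ (r - s) = c * s / (B * r)) (hT0 : 0 < T) (htT : T < t) :
    0 < deriv (trinomial r s a B c) t := by
  have ht := hT0.trans htT
  rw [deriv_trinomial_eq_mul hB.ne' hr.ne' hT ht]
  have := Real.rpow_lt_rpow hT0.le htT (sub_pos.2 hsr)
  exact mul_pos (by positivity) (sub_pos.2 this)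

theorem exists_trinomial_pos (ha : 0 < a) (hB : 0 < B) (hs : 0 < s) (hsr : s < r) (hc : 0 < c)
    {T : ℝ} (hT0 : 0 < T) (hT : T ^ (r - s) = c * s / (B * r)) :
    ∃ M, T < M ∧ 0 < trinomial r s a B c M := by
  have hr := hs.trans hsr
  have hd := sub_pos.2 hsr
  obtain ⟨M, hM0, hM⟩ := exists_pos_rpow_eq hd.ne' (div_pos hc hB)
  refine ⟨M, ?_, ?_⟩
  · rw [← Real.rpow_lt_rpow_iff hT0.le hM0.le hd, hT, hM, div_lt_div_iff₀ (by positivity) hB]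
    nlinarith [mul_pos (mul_pos hc hB) (sub_pos.2 hsr)]
  · have : trinomial r s a B c M = a := by
      rw [trinomial, show r = s + (r - s) by ring, Real.rpow_add hM0]
      simp only [hM]
      field_simp
      ring
    rwa [this]

end Trinomial

section PhiF

variable {p q γ a b c lam : ℝ}

theorem hasDerivAt_phiF (hp : p ≠ 0) (hq : q ≠ 0) (hγ : γ ≠ 0) {t : ℝ} (ht : 0 < t) :
    HasDerivAt (phiF p q γ a b c lam)
      (t ^ (p - 1) * trinomial (γ - p) (q - p) a (lam * b) c t) t := by
  have h := (((Real.hasDerivAt_rpow_const (p := p) (Or.inl ht.ne')).const_mul (a / p)).add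
    ((Real.hasDerivAt_rpow_const (p := γ) (Or.inl ht.ne')).const_mul (lam * b / γ))).sub
    ((Real.hasDerivAt_rpow_const (p := q) (Or.inl ht.ne')).const_mul (c / q))
  refine h.congr_deriv ?_
  rw [trinomial, show γ - 1 = (p - 1) + (γ - p) by ring, show q - 1 = (p - 1) + (q - p) by ring,
    Real.rpow_add ht, Real.rpow_add ht]
  field_simp

theorem deriv_deriv_phiF (hp : p ≠ 0) (hq : q ≠ 0) (hγ : γ ≠ 0) {t : ℝ} (ht : 0 < t)
    (hz : trinomial (γ - p) (q - p) a (lam * b) c t = 0) :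
    deriv (deriv (phiF p q γ a b c lam)) t =
      t ^ (p - 1) * deriv (trinomial (γ - p) (q - p) a (lam * b) c) t := by
  have heq : deriv (phiF p q γ a b c lam) =ᶠ[𝓝 t]
      fun x => x ^ (p - 1) * trinomial (γ - p) (q - p) a (lam * b) c x := by
    filter_upwards [Ioi_mem_nhds ht] with x hx
    exact (hasDerivAt_phiF hp hq hγ hx).deriv
  have h := (Real.hasDerivAt_rpow_const (p := p - 1) (Or.inl ht.ne')).mul
    (hasDerivAt_trinomial (r := γ - p) (s := q - p) (a := a) (B := lam * b) (c := c) ht)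
  rw [heq.deriv_eq, (hasDerivAt_trinomial ht).deriv]
  refine (h.congr_deriv ?_).deriv
  rw [hz, mul_zero, zero_add]

theorem altI_or_altII_or_altIII_phiF (hp : 1 < p) (hpq : p < q) (hqγ : q < γ)
    (ha : 0 < a) (hb : 0 < b) (hc : 0 < c) (hlam : 0 < lam) :
    AltI (phiF p q γ a b c lam) ∨ AltII (phiF p q γ a b c lam) ∨
      AltIII (phiF p q γ a b c lam) := by
  have hp0 : p ≠ 0 := by linarith
  have hq0 : q ≠ 0 := by linarith
  have hγ0 : γ ≠ 0 := by linarith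
  have hB : 0 < lam * b := mul_pos hlam hb
  have hs : 0 < q - p := sub_pos.2 hpq
  have hsr : q - p < γ - p := by linarith
  have hr : 0 < γ - p := hs.trans hsr
  obtain ⟨T, hT0, hT⟩ := exists_pos_rpow_eq (sub_pos.2 hsr).ne'
    (show 0 < c * (q - p) / (lam * b * (γ - p)) by positivity)
  set h := trinomial (γ - p) (q - p) a (lam * b) c with hh
  have hcont : Continuous h := continuous_trinomial hs.le hr.le
  have hneg : ∀ t, 0 < t → t < T → deriv h t < 0 := fun t => deriv_trinomial_neg hB hr hsr hT
  have hpos : ∀ t, T < t → 0 < deriv h t := fun t => deriv_trinomial_pos hB hr hsr hT hT0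
  have hanti : StrictAntiOn h (Icc 0 T) :=
    strictAntiOn_of_deriv_neg (convex_Icc 0 T) hcont.continuousOn fun t ht => by
      rw [interior_Icc] at ht
      exact hneg t ht.1 ht.2
  have hmono : StrictMonoOn h (Ici T) :=
    strictMonoOn_of_deriv_pos (convex_Ici T) hcont.continuousOn fun t ht => by
      rw [interior_Ici] at ht
      exact hpos t ht
  have hmin : ∀ t, 0 < t → t ≠ T → h T < h t := by
    intro t ht hne
    rcases hne.lt_or_gt with hlt | hgt
    · exact hanti ⟨ht.le, hlt.le⟩ ⟨hT0.le, le_rfl⟩ hlt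
    · exact hmono self_mem_Ici hgt.le hgt
  have hderiv : ∀ t, 0 < t → HasDerivAt (phiF p q γ a b c lam) (t ^ (p - 1) * h t) t :=
    fun t ht => hasDerivAt_phiF hp0 hq0 hγ0 ht
  have hcontφ : ContinuousOn (phiF p q γ a b c lam) (Ioi 0) := fun t ht =>
    (hderiv t ht).continuousAt.continuousWithinAt
  have hcrit : ∀ t, 0 < t → (deriv (phiF p q γ a b c lam) t = 0 ↔ h t = 0) := by
    intro t ht
    rw [(hderiv t ht).deriv, mul_eq_zero, or_iff_right (Real.rpow_pos_of_pos ht _).ne']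
  have hdd : ∀ t, 0 < t → h t = 0 →
      deriv (deriv (phiF p q γ a b c lam)) t = t ^ (p - 1) * deriv h t :=
    fun t ht hz => deriv_deriv_phiF hp0 hq0 hγ0 ht hz
  rcases lt_trichotomy (h T) 0 with hT1 | hT1 | hT1
  · left
    have h0 : h 0 = a := by
      simp [hh, trinomial, Real.zero_rpow hr.ne', Real.zero_rpow hs.ne']
    obtain ⟨M, hTM, hM⟩ : ∃ M, T < M ∧ 0 < h M := exists_trinomial_pos ha hB hs hsr hc hT0 hT
    obtain ⟨t1, ⟨ht1, ht1T⟩, hz1⟩ := intermediate_value_Ioo' hT0.le hcont.continuousOn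
      (show (0 : ℝ) ∈ Ioo (h T) (h 0) from ⟨hT1, h0 ▸ ha⟩)
    obtain ⟨t2, ⟨hTt2, -⟩, hz2⟩ := intermediate_value_Ioo hTM.le hcont.continuousOn
      (show (0 : ℝ) ∈ Ioo (h T) (h M) from ⟨hT1, hM⟩)
    have ht2 := hT0.trans hTt2
    have hd1 := (hcrit t1 ht1).2 hz1
    have hd2 := (hcrit t2 ht2).2 hz2
    have hdd1 : deriv (deriv (phiF p q γ a b c lam)) t1 < 0 := by
      rw [hdd t1 ht1 hz1]
      exact mul_neg_of_pos_of_neg (Real.rpow_pos_of_pos ht1 _) (hneg t1 ht1 ht1T)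
    have hdd2 : 0 < deriv (deriv (phiF p q γ a b c lam)) t2 := by
      rw [hdd t2 ht2 hz2]
      exact mul_pos (Real.rpow_pos_of_pos ht2 _) (hpos t2 hTt2)
    refine ⟨t1, t2, ht1, ht1T.trans hTt2, hd1, hd2, fun t ht hd => ?_,
      hdd1, isLocalMax_of_deriv_deriv_neg hdd1 hd1 (hderiv t1 ht1).continuousAt,
      hdd2, isLocalMin_of_deriv_deriv_pos hdd2 hd2 (hderiv t2 ht2).continuousAt⟩
    have hz := (hcrit t ht).1 hd
    rcases le_total t T with htT | htT
    · exact Or.inl (hanti.injOn ⟨ht.le, htT⟩ ⟨ht1.le, ht1T.le⟩ (hz.trans hz1.symm))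
    · exact Or.inr (hmono.injOn htT hTt2.le (hz.trans hz2.symm))
  · right; left
    refine ⟨T, hT0, (hcrit T hT0).2 hT1, fun t ht hd => ?_, ?_, ?_⟩
    · by_contra hne
      exact (hT1 ▸ hmin t ht hne).ne' ((hcrit t ht).1 hd)
    · rw [hdd T hT0 hT1, hh, deriv_trinomial_eq_mul hB.ne' hr.ne' hT hT0, sub_self, mul_zero,
        mul_zero]
    · refine monotoneOn_of_deriv_nonneg (convex_Ioi 0) hcontφ ?_ ?_ <;> rw [interior_Ioi]
      · exact fun t ht => (hderiv t ht).differentiableAt.differentiableWithinAt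
      · intro t ht
        rw [(hderiv t ht).deriv]
        refine mul_nonneg (Real.rpow_nonneg (le_of_lt ht) _) ?_
        rcases eq_or_ne t T with rfl | hne
        · exact hT1.ge
        · exact hT1 ▸ (hmin t ht hne).le
  · right; right
    have hφ : ∀ t, 0 < t → 0 < deriv (phiF p q γ a b c lam) t := by
      intro t ht
      rw [(hderiv t ht).deriv]
      refine mul_pos (Real.rpow_pos_of_pos ht _) ?_
      rcases eq_or_ne t T with rfl | hne
      · exact hT1
      · exact hT1.trans (hmin t ht hne)
    refine ⟨hφ, strictMonoOn_of_deriv_pos (convex_Ioi 0) hcontφ fun t ht => ?_,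
      fun t ht => (hφ t ht).ne'⟩
    rw [interior_Ioi] at ht
    exact hφ t ht

end PhiF

theorem stmt7 (p q γ a b c lam : ℝ)
    (hp : 1 < p) (hpq : p < q) (hqγ : q < γ)
    (ha : 0 < a) (hb : 0 < b) (hc : 0 < c) (hlam : 0 < lam) :
    (AltI (phiF p q γ a b c lam) ∧ ¬AltII (phiF p q γ a b c lam) ∧
      ¬AltIII (phiF p q γ a b c lam)) ∨
    (¬AltI (phiF p q γ a b c lam) ∧ AltII (phiF p q γ a b c lam) ∧
      ¬AltIII (phiF p q γ a b c lam)) ∨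
    (¬AltI (phiF p q γ a b c lam) ∧ ¬AltII (phiF p q γ a b c lam) ∧
      AltIII (phiF p q γ a b c lam)) := by
  rcases altI_or_altII_or_altIII_phiF hp hpq hqγ ha hb hc hlam with h | h | h
  · exact Or.inl ⟨h, h.not_altII, h.not_altIII⟩
  · exact Or.inr (Or.inl ⟨fun h1 => h1.not_altII h, h, h.not_altIII⟩)
  · exact Or.inr (Or.inr ⟨fun h1 => h1.not_altIII h, fun h2 => h2.not_altIII h, h⟩)
end

section
/- Let λ₀ := (γ/q)·((q−p)/(γ−p))·((p/q)·(γ−q)/(γ−p))^{(γ−q)/(q−p)} · c^{(γ−p)/(q−p)} / (b · a^{(γ−q)/(q−p)}). If 0 < λ < λ₀ then there exists t > 0 with φ_λ(t) < 0 (so inf_{t>0} φ_λ(t) < 0), while if λ ≥ λ₀ then φ_λ(t) ≥ 0 for all t > 0. -/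
open Filter Topology Set

noncomputable def lamZeroC (p q γ a b c : ℝ) : ℝ :=
  (γ / q) * ((q - p) / (γ - p)) * ((p / q) * ((γ - q) / (γ - p))) ^ ((γ - q) / (q - p)) *
    c ^ ((γ - p) / (q - p)) / (b * a ^ ((γ - q) / (q - p)))

/-- Weighted AM-GM for the powers `t ^ p` and `t ^ γ`, normalized to be an equality at `t = s`. -/
lemma rpow_le_weighted_rpow_add_rpow {p q γ s t : ℝ} (hpq : p < q) (hqγ : q < γ)
    (hs : 0 < s) (ht : 0 < t) :
    t ^ q ≤ (γ - q) / (γ - p) * (s ^ (q - p) * t ^ p) +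
      (q - p) / (γ - p) * (s ^ (q - γ) * t ^ γ) := by
  have hγp : 0 < γ - p := by linarith
  have hw : (γ - q) / (γ - p) + (q - p) / (γ - p) = 1 := by field_simp; ring
  have key := Real.geom_mean_le_arith_mean2_weighted
    (div_nonneg (sub_nonneg.2 hqγ.le) hγp.le) (div_nonneg (sub_nonneg.2 hpq.le) hγp.le)
    (by positivity : 0 ≤ s ^ (q - p) * t ^ p) (by positivity : 0 ≤ s ^ (q - γ) * t ^ γ) hw
  refine le_of_eq_of_le ?_ key
  rw [Real.mul_rpow (by positivity) (by positivity), Real.mul_rpow (by positivity) (by positivity),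
    ← Real.rpow_mul hs.le, ← Real.rpow_mul hs.le, ← Real.rpow_mul ht.le, ← Real.rpow_mul ht.le,
    mul_mul_mul_comm, ← Real.rpow_add hs, ← Real.rpow_add ht]
  have hs0 : (q - p) * ((γ - q) / (γ - p)) + (q - γ) * ((q - p) / (γ - p)) = 0 := by ring
  have htq : p * ((γ - q) / (γ - p)) + γ * ((q - p) / (γ - p)) = q := by field_simp; ring
  rw [hs0, htq, Real.rpow_zero, one_mul]

/-- The critical point `s` of `phiF` at the threshold parameter, where `phiF` vanishes as well. -/
lemma exists_critical_point {p q γ a b c : ℝ} (hp : 0 < p) (hpq : p < q) (hqγ : q < γ)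
    (ha : 0 < a) (hb : 0 < b) (hc : 0 < c) :
    ∃ s : ℝ, 0 < s ∧ a / p = c / q * ((γ - q) / (γ - p) * s ^ (q - p)) ∧
      lamZeroC p q γ a b c * b / γ = c / q * ((q - p) / (γ - p) * s ^ (q - γ)) := by
  have hq : 0 < q := by linarith
  have hγ : 0 < γ := by linarith
  have hγp : 0 < γ - p := by linarith
  have hγq : 0 < γ - q := by linarith
  have hqp : 0 < q - p := by linarith
  have hm : 0 < p / q * ((γ - q) / (γ - p)) := by positivity
  have hK : 0 < p / q * ((γ - q) / (γ - p)) * (c / a) := by positivity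
  refine ⟨(p / q * ((γ - q) / (γ - p)) * (c / a)) ^ (-1 / (q - p)), by positivity, ?_, ?_⟩
  · rw [← Real.rpow_mul hK.le, div_mul_cancel₀ _ hqp.ne', Real.rpow_neg_one]
    field_simp
  · have he : -1 / (q - p) * (q - γ) = (γ - q) / (q - p) := by ring
    have hce : (γ - p) / (q - p) = 1 + (γ - q) / (q - p) := by field_simp; ring
    rw [← Real.rpow_mul hK.le, he, Real.mul_rpow hm.le (by positivity),
      Real.div_rpow hc.le ha.le, lamZeroC, hce, Real.rpow_add hc, Real.rpow_one]
    generalize (p / q * ((γ - q) / (γ - p))) ^ ((γ - q) / (q - p)) = M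
    have hA : 0 < a ^ ((γ - q) / (q - p)) := by positivity
    field_simp

theorem stmt9 (p q γ a b c : ℝ)
    (hp : 1 < p) (hpq : p < q) (hqγ : q < γ)
    (ha : 0 < a) (hb : 0 < b) (hc : 0 < c) :
    ∀ lam : ℝ, 0 < lam →
      (lam < lamZeroC p q γ a b c → ∃ t : ℝ, 0 < t ∧ phiF p q γ a b c lam t < 0) ∧
      (lamZeroC p q γ a b c ≤ lam → ∀ t : ℝ, 0 < t → 0 ≤ phiF p q γ a b c lam t) := by
  intro lam _
  have hq : 0 < q := by linarith
  have hγ : 0 < γ := by linarith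
  have hγp : 0 < γ - p := by linarith
  obtain ⟨s, hs, hsa, hsl⟩ := exists_critical_point (by linarith) hpq hqγ ha hb hc
  refine ⟨fun hlam => ⟨s, hs, ?_⟩, fun hlam t ht => ?_⟩
  · have hlt : lam * b / γ * s ^ γ < lamZeroC p q γ a b c * b / γ * s ^ γ := by gcongr
    have hzero : a / p * s ^ p + lamZeroC p q γ a b c * b / γ * s ^ γ = c / q * s ^ q := by
      have h₁ : s ^ (q - p) * s ^ p = s ^ q := by rw [← Real.rpow_add hs, sub_add_cancel]
      have h₂ : s ^ (q - γ) * s ^ γ = s ^ q := by rw [← Real.rpow_add hs, sub_add_cancel]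
      have hw : (γ - q) / (γ - p) + (q - p) / (γ - p) = 1 := by field_simp; ring
      rw [hsa, hsl]
      linear_combination c / q * ((γ - q) / (γ - p)) * h₁ + c / q * ((q - p) / (γ - p)) * h₂ +
        c / q * s ^ q * hw
    simp only [phiF]
    linarith
  · have hle : lamZeroC p q γ a b c * b / γ * t ^ γ ≤ lam * b / γ * t ^ γ := by gcongr
    have hamgm := mul_le_mul_of_nonneg_left (rpow_le_weighted_rpow_add_rpow hpq hqγ hs ht)
      (div_pos hc hq).le
    rw [hsl] at hle
    simp only [phiF]
    rw [hsa]
    linarith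
end

section
/- Assume (H), (E1) and (E3). Then the map u ↦ λ₀(u), defined on X \ {0}, is 0-homogeneous (λ₀(tu) = λ₀(u) for all t > 0 and u ≠ 0), continuous on X \ {0}, and bounded from above; in particular λ₀* = sup{λ₀(u) : u ≠ 0} is finite. -/
open Filter Topology Set

theorem lamZero_smul {X : Type*} [NormedAddCommGroup X] [NormedSpace ℝ X]
    {p q γ : ℝ} (hpq : p ≠ q) {P T Q : X → ℝ} {t : ℝ} (ht : 0 < t) {u : X}
    (hP : P (t • u) = t ^ p * P u) (hT : T (t • u) = t ^ γ * T u)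
    (hQ : Q (t • u) = t ^ q * Q u) (hPu : 0 ≤ P u) (hQu : 0 ≤ Q u) :
    lamZero p q γ P T Q (t • u) = lamZero p q γ P T Q u := by
  have hexp : q * ((γ - p) / (q - p)) = γ + p * ((γ - q) / (q - p)) := by
    have : q - p ≠ 0 := sub_ne_zero.mpr hpq.symm
    field_simp
    ring
  have hnum : Q (t • u) ^ ((γ - p) / (q - p)) =
      t ^ (γ + p * ((γ - q) / (q - p))) * Q u ^ ((γ - p) / (q - p)) := by
    rw [hQ, Real.mul_rpow (by positivity) hQu, ← Real.rpow_mul ht.le, hexp]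
  have hden : T (t • u) * P (t • u) ^ ((γ - q) / (q - p)) =
      t ^ (γ + p * ((γ - q) / (q - p))) * (T u * P u ^ ((γ - q) / (q - p))) := by
    rw [hT, hP, Real.mul_rpow (by positivity) hPu, ← Real.rpow_mul ht.le, Real.rpow_add ht]
    ring
  have hscale : t ^ (γ + p * ((γ - q) / (q - p))) ≠ 0 := (Real.rpow_pos_of_pos ht _).ne'
  unfold lamZero
  rw [hnum, hden, mul_left_comm, mul_div_mul_left _ _ hscale]

theorem continuousOn_lamZero {X : Type*} [NormedAddCommGroup X] [NormedSpace ℝ X]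
    (p q γ : ℝ) {P T Q : X → ℝ} {s : Set X} (hP : ContinuousOn P s) (hT : ContinuousOn T s)
    (hQ : ContinuousOn Q s) (hpos : ∀ u ∈ s, 0 < P u ∧ 0 < T u ∧ 0 < Q u) :
    ContinuousOn (lamZero p q γ P T Q) s := by
  unfold lamZero
  refine ContinuousOn.div
    (continuousOn_const.mul (hQ.rpow_const fun u hu => Or.inl (hpos u hu).2.2.ne'))
    (hT.mul (hP.rpow_const fun u hu => Or.inl (hpos u hu).1.ne')) fun u hu => ?_
  exact (mul_pos (hpos u hu).2.1 (Real.rpow_pos_of_pos (hpos u hu).1 _)).ne'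

theorem lamZero_le {X : Type*} [NormedAddCommGroup X] [NormedSpace ℝ X]
    {p q γ C : ℝ} (hp : 0 < p) (hpq : p < q) (hqγ : q < γ) {P T Q : X → ℝ} {u : X}
    (hPu : 0 < P u) (hTu : 0 < T u)
    (hC : Q u ^ ((γ - p) / (q - p)) ≤ C * (T u * P u ^ ((γ - q) / (q - p)))) :
    lamZero p q γ P T Q u ≤
      (γ / q) * ((q - p) / (γ - p)) *
        ((p / q) * ((γ - q) / (γ - p))) ^ ((γ - q) / (q - p)) * C := by
  have hq : 0 < q := hp.trans hpq
  have hγ : 0 < γ := hq.trans hqγ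
  have h₁ : 0 < q - p := sub_pos.mpr hpq
  have h₂ : 0 < γ - q := sub_pos.mpr hqγ
  have h₃ : 0 < γ - p := sub_pos.mpr (hpq.trans hqγ)
  unfold lamZero
  rw [mul_div_assoc]
  gcongr
  exact (div_le_iff₀ (by positivity)).mpr hC

theorem stmt10
    {X : Type*} [NormedAddCommGroup X] [NormedSpace ℝ X] [CompleteSpace X]
    (hrefl : Function.Surjective ⇑(NormedSpace.inclusionInDoubleDual ℝ X))
    (p q γ : ℝ) (hp : 1 < p) (hpq : p < q) (hqγ : q < γ)
    (P T Q : X → ℝ)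
    (hPd : ContDiff ℝ 1 P) (hTd : ContDiff ℝ 1 T) (hQd : ContDiff ℝ 1 Q)
    (hH : ∀ t : ℝ, 0 < t → ∀ u : X,
      P (t • u) = t ^ p * P u ∧ T (t • u) = t ^ γ * T u ∧ Q (t • u) = t ^ q * Q u)
    (hE1 : ∀ u : X, u ≠ 0 → 0 < P u ∧ 0 < T u ∧ 0 < Q u)
    (hE3 : ∃ C : ℝ, 0 < C ∧ ∀ u : X, u ≠ 0 →
      Q u ^ ((γ - p) / (q - p)) ≤ C * (T u * P u ^ ((γ - q) / (q - p))))
 :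
    (∀ t : ℝ, 0 < t → ∀ u : X, u ≠ 0 →
      lamZero p q γ P T Q (t • u) = lamZero p q γ P T Q u) ∧
    ContinuousOn (lamZero p q γ P T Q) {u : X | u ≠ 0} ∧
    (∃ M : ℝ, ∀ u : X, u ≠ 0 → lamZero p q γ P T Q u ≤ M) ∧
    BddAbove {l : ℝ | ∃ u : X, u ≠ 0 ∧ l = lamZero p q γ P T Q u} := by
  obtain ⟨C, -, hC⟩ := hE3
  have hp₀ : 0 < p := one_pos.trans hp
  obtain ⟨M, hM⟩ : ∃ M : ℝ, ∀ u : X, u ≠ 0 → lamZero p q γ P T Q u ≤ M :=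
    ⟨_, fun u hu => lamZero_le hp₀ hpq hqγ (hE1 u hu).1 (hE1 u hu).2.1 (hC u hu)⟩
  refine ⟨fun t ht u hu => ?_, ?_, ⟨M, hM⟩, ⟨M, ?_⟩⟩
  · obtain ⟨hP, hT, hQ⟩ := hH t ht u
    exact lamZero_smul hpq.ne ht hP hT hQ (hE1 u hu).1.le (hE1 u hu).2.2.le
  · exact continuousOn_lamZero p q γ hPd.continuous.continuousOn hTd.continuous.continuousOn
      hQd.continuous.continuousOn hE1
  · rintro _ ⟨u, hu, rfl⟩
    exact hM u hu
end

section
/- Assume (H), (E1) and (E3). For every λ > 0, there exists u ∈ X with Φ_λ(u) < 0 if and only if 0 < λ < λ₀*. -/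
open Filter Topology Set

theorem lt_of_add_mul_lt {a b x y z l : ℝ} (ha : 0 < a) (hb : 0 < b) (hab : a + b = 1)
    (hx : 0 < x) (hy : 0 < y) (hz : 0 < z) (h : y + l * z < x) :
    l < b * (x / z) * (a * x / y) ^ (a / b) := by
  by_contra! hl
  have hr : 0 < a * x / y := by positivity
  have hB : x * (a * x / y) ^ (a / b) ≤ l * z / b := by
    calc x * (a * x / y) ^ (a / b) = b * (x / z) * (a * x / y) ^ (a / b) * z / b := by field_simp
      _ ≤ l * z / b := by gcongr
  have hB0 : 0 ≤ x * (a * x / y) ^ (a / b) := by positivity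
  have amgm := Real.geom_mean_le_arith_mean2_weighted ha.le hb.le
    (p₁ := y / a) (p₂ := l * z / b) (by positivity) (hB0.trans hB) hab
  have hlow : x ≤ (y / a) ^ a * (l * z / b) ^ b := by
    calc x = (y / a) ^ a * (x * (a * x / y) ^ (a / b)) ^ b := by
          rw [Real.mul_rpow hx.le (by positivity), ← Real.rpow_mul hr.le, div_mul_cancel₀ _ hb.ne',
            mul_left_comm, ← Real.mul_rpow (by positivity) hr.le]
          rw [show y / a * (a * x / y) = x by field_simp, ← Real.rpow_add hx, add_comm, hab,
            Real.rpow_one]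
      _ ≤ _ := by gcongr
  have : a * (y / a) + b * (l * z / b) = y + l * z := by field_simp
  linarith

theorem exists_rpow_add_mul_lt {p q r x y z l : ℝ} (hpq : p < q) (hqr : q < r)
    (hx : 0 < x) (hy : 0 < y) (hz : 0 < z)
    (h : l < (q - p) / (r - p) * (x / z) * ((r - q) / (r - p) * x / y) ^ ((r - q) / (q - p))) :
    ∃ t : ℝ, 0 < t ∧ t ^ p * y + l * (t ^ r * z) < t ^ q * x := by
  have hqp : 0 < q - p := sub_pos.2 hpq
  have hrq : 0 < r - q := sub_pos.2 hqr
  have hrp : 0 < r - p := by linarith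
  set m := (r - q) / (r - p) * x / y with hm
  have hm0 : 0 < m := by positivity
  refine ⟨m⁻¹ ^ (1 / (q - p)), by positivity, ?_⟩
  set t := m⁻¹ ^ (1 / (q - p)) with ht
  have ht0 : 0 < t := by positivity
  have hq : t ^ q = t ^ p * m⁻¹ := by
    rw [show q = p + (q - p) by ring, Real.rpow_add ht0, ht, ← Real.rpow_mul (by positivity) _ (q - p)]
    simp [hqp.ne']
  have hr : t ^ r = t ^ q * (m ^ ((r - q) / (q - p)))⁻¹ := by
    rw [show r = q + (r - q) by ring, Real.rpow_add ht0, ← Real.inv_rpow hm0.le, add_sub_cancel_left]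
    congr 1
    rw [ht, ← Real.rpow_mul (by positivity)]
    congr 1
    ring
  have hy' : t ^ p * y = t ^ q * ((r - q) / (r - p) * x) := by
    rw [hq, hm]; field_simp
  have hM : 0 < m ^ ((r - q) / (q - p)) := by positivity
  set M := m ^ ((r - q) / (q - p))
  have hl : l * (M⁻¹ * z) < (q - p) / (r - p) * x := by
    calc l * (M⁻¹ * z) < (q - p) / (r - p) * (x / z) * M * (M⁻¹ * z) := by gcongr
      _ = _ := by field_simp
  have hsum : (r - q) / (r - p) * x + (q - p) / (r - p) * x = x := by field_simp; ring
  rw [hy', hr]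
  have : t ^ q * ((r - q) / (r - p) * x + l * (M⁻¹ * z)) < t ^ q * x := by
    gcongr
    linarith
  linarith

theorem lamZero_eq {X : Type*} [NormedAddCommGroup X] [NormedSpace ℝ X] {p q γ : ℝ}
    (hp : 0 < p) (hpq : p < q) (hqγ : q < γ) {P T Q : X → ℝ} {u : X}
    (hP : 0 < P u) (hT : 0 < T u) (hQ : 0 < Q u) :
    lamZero p q γ P T Q u = (q - p) / (γ - p) * ((Q u / q) / (T u / γ)) *
      ((γ - q) / (γ - p) * (Q u / q) / (P u / p)) ^ ((γ - q) / (q - p)) := by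
  have hqp : 0 < q - p := sub_pos.2 hpq
  have hγq : 0 < γ - q := sub_pos.2 hqγ
  have hγp : 0 < γ - p := by linarith
  have hq : 0 < q := by linarith
  have hγ : 0 < γ := by linarith
  have e : (γ - p) / (q - p) = 1 + (γ - q) / (q - p) := by field_simp; ring
  have e' : (γ - q) / (γ - p) * (Q u / q) / (P u / p)
      = p / q * ((γ - q) / (γ - p)) * Q u / P u := by field_simp
  have hc : 0 < p / q * ((γ - q) / (γ - p)) := by positivity
  rw [lamZero, e, e', Real.rpow_add hQ, Real.rpow_one, Real.div_rpow (by positivity) hP.le,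
    Real.mul_rpow hc.le hQ.le]
  field_simp

theorem stmt11
    {X : Type*} [NormedAddCommGroup X] [NormedSpace ℝ X] [CompleteSpace X]
    (hrefl : Function.Surjective ⇑(NormedSpace.inclusionInDoubleDual ℝ X))
    (p q γ : ℝ) (hp : 1 < p) (hpq : p < q) (hqγ : q < γ)
    (P T Q : X → ℝ)
    (hPd : ContDiff ℝ 1 P) (hTd : ContDiff ℝ 1 T) (hQd : ContDiff ℝ 1 Q)
    (hH : ∀ t : ℝ, 0 < t → ∀ u : X,
      P (t • u) = t ^ p * P u ∧ T (t • u) = t ^ γ * T u ∧ Q (t • u) = t ^ q * Q u)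
    (hE1 : ∀ u : X, u ≠ 0 → 0 < P u ∧ 0 < T u ∧ 0 < Q u)
    (hE3 : ∃ C : ℝ, 0 < C ∧ ∀ u : X, u ≠ 0 →
      Q u ^ ((γ - p) / (q - p)) ≤ C * (T u * P u ^ ((γ - q) / (q - p))))
 :
    ∀ lam : ℝ, 0 < lam →
      ((∃ u : X, Phi p q γ lam P T Q u < 0) ↔ lam < lamZeroStar p q γ P T Q) := by
  obtain ⟨C, -, hC⟩ := hE3
  have hp0 : 0 < p := by linarith
  have hq0 : 0 < q := by linarith
  have hγ0 : 0 < γ := by linarith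
  have hqp : 0 < q - p := sub_pos.2 hpq
  have hγq : 0 < γ - q := sub_pos.2 hqγ
  have hγp : 0 < γ - p := by linarith
  have hbdd : BddAbove {l : ℝ | ∃ u : X, u ≠ 0 ∧ l = lamZero p q γ P T Q u} := by
    refine ⟨(γ / q) * ((q - p) / (γ - p)) *
      ((p / q) * ((γ - q) / (γ - p))) ^ ((γ - q) / (q - p)) * C, ?_⟩
    rintro _ ⟨u, hu, rfl⟩
    obtain ⟨hPu, hTu, -⟩ := hE1 u hu
    rw [lamZero, div_le_iff₀ (by positivity), mul_assoc _ C]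
    gcongr
    exact hC u hu
  have hzero : ∀ (F : X → ℝ) (r : ℝ), 0 < r → F ((2 : ℝ) • (0 : X)) = 2 ^ r * F 0 → F 0 = 0 := by
    intro F r hr h
    rw [smul_zero] at h
    have h1 : (1 : ℝ) < 2 ^ r := Real.one_lt_rpow one_lt_two hr
    have h2 : ((2 : ℝ) ^ r - 1) * F 0 = 0 := by linarith
    exact (mul_eq_zero.1 h2).resolve_left (by linarith)
  intro lam hlam
  constructor
  · rintro ⟨u, hu⟩
    have hu0 : u ≠ 0 := by
      rintro rfl
      obtain ⟨h1, h2, h3⟩ := hH 2 two_pos 0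
      simp [Phi, hzero P p hp0 h1, hzero T γ hγ0 h2, hzero Q q hq0 h3] at hu
    obtain ⟨hPu, hTu, hQu⟩ := hE1 u hu0
    refine lt_of_lt_of_le ?_ (le_csSup hbdd ⟨u, hu0, rfl⟩)
    rw [lamZero_eq hp0 hpq hqγ hPu hTu hQu]
    have h := lt_of_add_mul_lt (a := (γ - q) / (γ - p)) (b := (q - p) / (γ - p))
      (x := Q u / q) (y := P u / p) (z := T u / γ) (l := lam) (by positivity) (by positivity)
      (by field_simp; ring) (by positivity) (by positivity) (by positivity)
      (by
        rw [Phi] at hu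
        have : (1 / p) * P u + (lam / γ) * T u - (1 / q) * Q u
          = P u / p + lam * (T u / γ) - Q u / q := by ring
        linarith)
    rwa [div_div_div_cancel_right₀ hγp.ne'] at h
  · intro h
    have hne : {l : ℝ | ∃ u : X, u ≠ 0 ∧ l = lamZero p q γ P T Q u}.Nonempty := by
      by_contra hempty
      rw [lamZeroStar, Set.not_nonempty_iff_eq_empty.1 hempty, Real.sSup_empty] at h
      linarith
    obtain ⟨_, ⟨u, hu0, rfl⟩, hu⟩ := exists_lt_of_lt_csSup hne h
    obtain ⟨hPu, hTu, hQu⟩ := hE1 u hu0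
    rw [lamZero_eq hp0 hpq hqγ hPu hTu hQu] at hu
    obtain ⟨t, ht, hlt⟩ := exists_rpow_add_mul_lt hpq hqγ (by positivity) (by positivity)
      (by positivity) hu
    obtain ⟨h1, h2, h3⟩ := hH t ht u
    refine ⟨t • u, ?_⟩
    rw [Phi, h1, h2, h3]
    have : (1 / p) * (t ^ p * P u) + (lam / γ) * (t ^ γ * T u) - (1 / q) * (t ^ q * Q u)
      = t ^ p * (P u / p) + lam * (t ^ γ * (T u / γ)) - t ^ q * (Q u / q) := by ring
    linarith
end

section
/- Assume (H), (E1) and (E3). If u ∈ N_{λ*}, i.e. u ≠ 0 and 𝒫(u) + λ*𝒯(u) = 𝒬(u), then the Fréchet derivatives satisfy 𝒫′(u) + λ*·𝒯′(u) − 𝒬′(u) = 0 in X*. -/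
open Filter Topology Set

/-- Weighted AM-GM inequality with weights `θ` and `1 - θ`, for the extremal coefficient of `T`. -/
theorem le_add_of_weighted_am_gm {θ a b P T Q : ℝ} (hθ0 : 0 < θ) (hθ1 : θ < 1)
    (ha : a * (1 - θ) = 1) (hb : b * (1 - θ) = θ) (hP : 0 < P) (hT : 0 < T) (hQ : 0 < Q) :
    Q ≤ P + (1 - θ) * θ ^ b * Q ^ a / (T * P ^ b) * T := by
  have h1 : 0 < 1 - θ := by linarith
  have key := Real.geom_mean_le_arith_mean2_weighted hθ0.le h1.le (div_pos hP hθ0).le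
    (by positivity : 0 ≤ θ ^ b * Q ^ a / P ^ b) (by ring)
  have hgeom : (P / θ) ^ θ * (θ ^ b * Q ^ a / P ^ b) ^ (1 - θ) = Q := by
    rw [Real.div_rpow hP.le hθ0.le,
      Real.div_rpow (mul_pos (Real.rpow_pos_of_pos hθ0 b) (Real.rpow_pos_of_pos hQ a)).le
        (Real.rpow_pos_of_pos hP b).le,
      Real.mul_rpow (by positivity) (by positivity), ← Real.rpow_mul hθ0.le,
      ← Real.rpow_mul hQ.le, ← Real.rpow_mul hP.le, ha, hb, Real.rpow_one]
    field_simp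
  rw [hgeom] at key
  convert key using 1
  field_simp

theorem bddAbove_lamFun {X : Type*} [NormedAddCommGroup X] [NormedSpace ℝ X]
    {p q γ : ℝ} (hpq : p < q) (hqγ : q < γ) {P T Q : X → ℝ}
    (hpos : ∀ u : X, u ≠ 0 → 0 < P u ∧ 0 < T u ∧ 0 < Q u)
    (hbound : ∃ C : ℝ, 0 < C ∧ ∀ u : X, u ≠ 0 →
      Q u ^ ((γ - p) / (q - p)) ≤ C * (T u * P u ^ ((γ - q) / (q - p)))) :
    BddAbove {l : ℝ | ∃ u : X, u ≠ 0 ∧ l = lamFun p q γ P T Q u} := by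
  obtain ⟨C, -, hC⟩ := hbound
  refine ⟨(q - p) / (γ - p) * ((γ - q) / (γ - p)) ^ ((γ - q) / (q - p)) * C, ?_⟩
  rintro _ ⟨w, hw, rfl⟩
  obtain ⟨hP, hT, -⟩ := hpos w hw
  have h1 : 0 < q - p := by linarith
  have h2 : 0 < γ - q := by linarith
  have h3 : 0 < γ - p := by linarith
  rw [lamFun, div_le_iff₀ (by positivity), mul_assoc _ C]
  exact mul_le_mul_of_nonneg_left (hC w hw) (by positivity)

theorem le_add_lamFun_mul {X : Type*} [NormedAddCommGroup X] [NormedSpace ℝ X]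
    {p q γ : ℝ} (hpq : p < q) (hqγ : q < γ) {P T Q : X → ℝ} {w : X}
    (hP : 0 < P w) (hT : 0 < T w) (hQ : 0 < Q w) :
    Q w ≤ P w + lamFun p q γ P T Q w * T w := by
  have h1 : 0 < q - p := by linarith
  have h2 : 0 < γ - q := by linarith
  have h3 : 0 < γ - p := by linarith
  have hθ : 1 - (γ - q) / (γ - p) = (q - p) / (γ - p) := by
    field_simp
    ring
  have key := le_add_of_weighted_am_gm (θ := (γ - q) / (γ - p)) (a := (γ - p) / (q - p))
    (b := (γ - q) / (q - p)) (by positivity) (by rw [div_lt_one h3]; linarith)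
    (by rw [hθ]; field_simp) (by rw [hθ]; field_simp) hP hT hQ
  rwa [hθ] at key

theorem stmt15
    {X : Type*} [NormedAddCommGroup X] [NormedSpace ℝ X] [CompleteSpace X]
    (hrefl : Function.Surjective ⇑(NormedSpace.inclusionInDoubleDual ℝ X))
    (p q γ : ℝ) (hp : 1 < p) (hpq : p < q) (hqγ : q < γ)
    (P T Q : X → ℝ)
    (hPd : ContDiff ℝ 1 P) (hTd : ContDiff ℝ 1 T) (hQd : ContDiff ℝ 1 Q)
    (hH : ∀ t : ℝ, 0 < t → ∀ u : X,
      P (t • u) = t ^ p * P u ∧ T (t • u) = t ^ γ * T u ∧ Q (t • u) = t ^ q * Q u)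
    (hE1 : ∀ u : X, u ≠ 0 → 0 < P u ∧ 0 < T u ∧ 0 < Q u)
    (hE3 : ∃ C : ℝ, 0 < C ∧ ∀ u : X, u ≠ 0 →
      Q u ^ ((γ - p) / (q - p)) ≤ C * (T u * P u ^ ((γ - q) / (q - p))))
    (u : X) (hu : u ≠ 0) (huN : P u + lamStar p q γ P T Q * T u = Q u) :
    fderiv ℝ P u + lamStar p q γ P T Q • fderiv ℝ T u - fderiv ℝ Q u = 0 := by
  have hmin : IsLocalMin (fun w => P w + lamStar p q γ P T Q * T w - Q w) u := by
    filter_upwards [isOpen_ne.mem_nhds hu] with w hw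
    obtain ⟨hP, hT, hQ⟩ := hE1 w hw
    have hle : lamFun p q γ P T Q w ≤ lamStar p q γ P T Q :=
      le_csSup (bddAbove_lamFun hpq hqγ hE1 hE3) ⟨w, hw, rfl⟩
    have := le_add_lamFun_mul hpq hqγ hP hT hQ
    have := mul_le_mul_of_nonneg_right hle hT.le
    linarith
  have hP := (hPd.differentiable one_ne_zero u).hasFDerivAt
  have hT := (hTd.differentiable one_ne_zero u).hasFDerivAt
  have hQ := (hQd.differentiable one_ne_zero u).hasFDerivAt
  exact hmin.hasFDerivAt_eq_zero ((hP.add (hT.const_mul _)).sub hQ)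
end

section
/- Let λ_c := ((q−p)/(γ−p))·((γ−q)/(γ−p))^{(γ−q)/(q−p)} · c^{(γ−p)/(q−p)} / (b · a^{(γ−q)/(q−p)}) and t_c := ((1/λ_c)·((q−p)/(γ−p))·(c/b))^{1/(γ−q)}, and for 0 < λ < λ_c let t_λ⁻ < t_λ⁺ denote the two zeros of φ_λ′ in (0,∞). Then the map λ ↦ t_λ⁺ is strictly decreasing and continuous on (0, λ_c), the map λ ↦ t_λ⁻ is strictly increasing and continuous on (0, λ_c), and t_λ⁺ → t_c and t_λ⁻ → t_c as λ ↑ λ_c. -/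
open Filter Topology Set

noncomputable def lamCrit (p q γ a b c : ℝ) : ℝ :=
  ((q - p) / (γ - p)) * ((γ - q) / (γ - p)) ^ ((γ - q) / (q - p)) *
    c ^ ((γ - p) / (q - p)) / (b * a ^ ((γ - q) / (q - p)))

noncomputable def tCrit (p q γ a b c : ℝ) : ℝ :=
  ((1 / lamCrit p q γ a b c) * ((q - p) / (γ - p)) * (c / b)) ^ (1 / (γ - q))

/-- A right inverse of a function strictly monotone on an order-connected set is continuous. -/
theorem StrictMonoOn.tendsto_rightInverse {α β : Type*} [LinearOrder α] [TopologicalSpace α]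
    [OrderTopology α] [LinearOrder β] [TopologicalSpace β] [OrderTopology β] {h : α → β}
    {g : β → α} {s : Set α} {S : Set β} (hs : s.OrdConnected) (hh : StrictMonoOn h s)
    (hg : MapsTo g S s) (hinv : ∀ y ∈ S, h (g y) = y) {x : α} (hx : x ∈ s) :
    Tendsto g (𝓝[S] (h x)) (𝓝 x) := by
  refine tendsto_order.2 ⟨fun u hu => ?_, fun u hu => ?_⟩
  · by_cases hus : u ∈ s
    · filter_upwards [self_mem_nhdsWithin,
        mem_nhdsWithin_of_mem_nhds (lt_mem_nhds (hh hus hx hu))] with y hy hlt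
      rwa [← hinv y hy, hh.lt_iff_lt hus (hg hy)] at hlt
    · filter_upwards [self_mem_nhdsWithin] with y hy
      exact lt_of_not_ge fun hle => hus (hs.out (hg hy) hx ⟨hle, hu.le⟩)
  · by_cases hus : u ∈ s
    · filter_upwards [self_mem_nhdsWithin,
        mem_nhdsWithin_of_mem_nhds (gt_mem_nhds (hh hx hus hu))] with y hy hlt
      rwa [← hinv y hy, hh.lt_iff_lt (hg hy) hus] at hlt
    · filter_upwards [self_mem_nhdsWithin] with y hy
      exact lt_of_not_ge fun hle => hus (hs.out hx (hg hy) ⟨hu.le, hle⟩)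

/-- A right inverse of a function strictly antitone on an order-connected set is continuous. -/
theorem StrictAntiOn.tendsto_rightInverse {α β : Type*} [LinearOrder α] [TopologicalSpace α]
    [OrderTopology α] [LinearOrder β] [TopologicalSpace β] [OrderTopology β] {h : α → β}
    {g : β → α} {s : Set α} {S : Set β} (hs : s.OrdConnected) (hh : StrictAntiOn h s)
    (hg : MapsTo g S s) (hinv : ∀ y ∈ S, h (g y) = y) {x : α} (hx : x ∈ s) :
    Tendsto g (𝓝[S] (h x)) (𝓝 x) :=
  StrictMonoOn.tendsto_rightInverse (β := βᵒᵈ) hs hh.dual_right hg hinv hx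

/-- The value of the parameter for which `t` is a critical point of `phiF`. -/
noncomputable def critParam (p q γ a b c t : ℝ) : ℝ :=
  (c * t ^ (q - γ) - a * t ^ (p - γ)) / b

section

variable {p q γ a b c : ℝ}

theorem critParam_eq_of_deriv_eq_zero (hp : 0 < p) (hq : 0 < q) (hγ : 0 < γ) (hb : 0 < b)
    {lam t : ℝ} (ht : 0 < t) (h : deriv (phiF p q γ a b c lam) t = 0) :
    critParam p q γ a b c t = lam := by
  have hd : HasDerivAt (phiF p q γ a b c lam) ((a / p) * (p * t ^ (p - 1)) +
      (lam * b / γ) * (γ * t ^ (γ - 1)) - (c / q) * (q * t ^ (q - 1))) t :=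
    (((Real.hasDerivAt_rpow_const (Or.inl ht.ne')).const_mul _).add
      ((Real.hasDerivAt_rpow_const (Or.inl ht.ne')).const_mul _)).sub
      ((Real.hasDerivAt_rpow_const (Or.inl ht.ne')).const_mul _)
  rw [hd.deriv] at h
  have hpp : t ^ (p - 1) = t ^ (p - γ) * t ^ (γ - 1) := by
    rw [← Real.rpow_add ht]; ring_nf
  have hqq : t ^ (q - 1) = t ^ (q - γ) * t ^ (γ - 1) := by
    rw [← Real.rpow_add ht]; ring_nf
  have hpos : 0 < t ^ (γ - 1) := Real.rpow_pos_of_pos ht _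
  rw [hpp, hqq] at h
  field_simp at h
  rw [critParam, div_eq_iff hb.ne']
  linarith [(mul_eq_zero.1 h).resolve_left hpos.ne']

theorem hasDerivAt_critParam {t : ℝ} (ht : 0 < t) :
    HasDerivAt (critParam p q γ a b c)
      (t ^ (p - γ - 1) * (a * (γ - p) - c * (γ - q) * t ^ (q - p)) / b) t := by
  have hd := (((Real.hasDerivAt_rpow_const (p := q - γ) (Or.inl ht.ne')).const_mul c).sub
      ((Real.hasDerivAt_rpow_const (p := p - γ) (Or.inl ht.ne')).const_mul a)).div_const b
  refine hd.congr_deriv ?_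
  have : t ^ (q - γ - 1) = t ^ (p - γ - 1) * t ^ (q - p) := by
    rw [← Real.rpow_add ht]; ring_nf
  rw [this]
  ring

/-- The point at which `critParam` attains its maximum. -/
noncomputable def critParamArgmax (p q γ a c : ℝ) : ℝ :=
  (a * (γ - p) / (c * (γ - q))) ^ (1 / (q - p))

theorem critParamArgmax_pos (hpq : p < q) (hqγ : q < γ) (ha : 0 < a) (hc : 0 < c) :
    0 < critParamArgmax p q γ a c := by
  have h1 : 0 < γ - q := by linarith
  have h2 : 0 < γ - p := by linarith
  unfold critParamArgmax
  positivity

theorem critParamArgmax_rpow (hpq : p < q) (hqγ : q < γ) (ha : 0 < a) (hc : 0 < c) :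
    critParamArgmax p q γ a c ^ (q - p) = a * (γ - p) / (c * (γ - q)) := by
  have h1 : 0 < γ - q := by linarith
  have h2 : 0 < γ - p := by linarith
  rw [critParamArgmax, ← Real.rpow_mul (by positivity),
    one_div_mul_cancel (by linarith), Real.rpow_one]

theorem strictMonoOn_critParam (hpq : p < q) (hqγ : q < γ) (ha : 0 < a) (hb : 0 < b) (hc : 0 < c) :
    StrictMonoOn (critParam p q γ a b c) (Ioc 0 (critParamArgmax p q γ a c)) := by
  refine strictMonoOn_of_deriv_pos (convex_Ioc _ _)
    (fun t ht => (hasDerivAt_critParam ht.1).continuousAt.continuousWithinAt) fun t ht => ?_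
  rw [interior_Ioc] at ht
  have h1 : 0 < c * (γ - q) := mul_pos hc (by linarith)
  have hlt := Real.rpow_lt_rpow ht.1.le ht.2 (sub_pos.2 hpq)
  rw [critParamArgmax_rpow hpq hqγ ha hc, lt_div_iff₀ h1] at hlt
  rw [(hasDerivAt_critParam ht.1).deriv]
  exact div_pos (mul_pos (Real.rpow_pos_of_pos ht.1 _) (by linarith)) hb

theorem strictAntiOn_critParam (hpq : p < q) (hqγ : q < γ) (ha : 0 < a) (hb : 0 < b) (hc : 0 < c) :
    StrictAntiOn (critParam p q γ a b c) (Ici (critParamArgmax p q γ a c)) := by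
  have hT := critParamArgmax_pos hpq hqγ ha hc
  refine strictAntiOn_of_deriv_neg (convex_Ici _)
    (fun t ht => (hasDerivAt_critParam (hT.trans_le ht)).continuousAt.continuousWithinAt)
    fun t ht => ?_
  rw [interior_Ici] at ht
  have h1 : 0 < c * (γ - q) := mul_pos hc (by linarith)
  have hlt := Real.rpow_lt_rpow hT.le ht (sub_pos.2 hpq)
  rw [critParamArgmax_rpow hpq hqγ ha hc, div_lt_iff₀ h1] at hlt
  have ht0 : 0 < t := hT.trans ht
  rw [(hasDerivAt_critParam ht0).deriv]
  exact div_neg_of_neg_of_pos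
    (mul_neg_of_pos_of_neg (Real.rpow_pos_of_pos ht0 _) (by linarith)) hb

theorem critParam_argmax_eq (hpq : p < q) (hqγ : q < γ) (ha : 0 < a) (hc : 0 < c) :
    critParam p q γ a b c (critParamArgmax p q γ a c) =
    critParamArgmax p q γ a c ^ (q - γ) * ((q - p) / (γ - p)) * (c / b) := by
  have hT := critParamArgmax_pos hpq hqγ ha hc
  have h1 : 0 < γ - q := by linarith
  have h2 : 0 < γ - p := by linarith
  have hTq := critParamArgmax_rpow hpq hqγ ha hc
  have hsplit : critParamArgmax p q γ a c ^ (q - γ) =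
      critParamArgmax p q γ a c ^ (p - γ) * (a * (γ - p) / (c * (γ - q))) := by
    rw [← hTq, ← Real.rpow_add hT]; ring_nf
  rw [critParam, hsplit]
  field_simp
  ring

theorem critParam_argmax (hpq : p < q) (hqγ : q < γ) (ha : 0 < a) (hb : 0 < b) (hc : 0 < c) :
    critParam p q γ a b c (critParamArgmax p q γ a c) = lamCrit p q γ a b c := by
  have h0 : 0 < q - p := by linarith
  have h1 : 0 < γ - q := by linarith
  have h2 : 0 < γ - p := by linarith
  rw [critParam_argmax_eq hpq hqγ ha hc, lamCrit, critParamArgmax,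
    ← Real.rpow_mul (by positivity),
    show 1 / (q - p) * (q - γ) = -((γ - q) / (q - p)) by ring, Real.rpow_neg (by positivity),
    ← Real.inv_rpow (by positivity),
    show (a * (γ - p) / (c * (γ - q)))⁻¹ = (γ - q) / (γ - p) * (c / a) by field_simp,
    Real.mul_rpow (by positivity) (by positivity), Real.div_rpow hc.le ha.le,
    show (γ - p) / (q - p) = (γ - q) / (q - p) + 1 by field_simp; ring,
    Real.rpow_add_one hc.ne']
  field_simp

theorem lamCrit_pos (hpq : p < q) (hqγ : q < γ) (ha : 0 < a) (hb : 0 < b) (hc : 0 < c) :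
    0 < lamCrit p q γ a b c := by
  have h0 : 0 < q - p := by linarith
  have h1 : 0 < γ - q := by linarith
  have h2 : 0 < γ - p := by linarith
  unfold lamCrit
  positivity

theorem tCrit_eq_critParamArgmax (hpq : p < q) (hqγ : q < γ) (ha : 0 < a) (hb : 0 < b)
    (hc : 0 < c) :
    tCrit p q γ a b c = critParamArgmax p q γ a c := by
  have hT := critParamArgmax_pos hpq hqγ ha hc
  have h0 : 0 < q - p := by linarith
  have h1 : 0 < γ - q := by linarith
  have h2 : 0 < γ - p := by linarith
  rw [tCrit, ← critParam_argmax hpq hqγ ha hb hc, critParam_argmax_eq hpq hqγ ha hc]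
  have hpow : 1 / (critParamArgmax p q γ a c ^ (q - γ) * ((q - p) / (γ - p)) * (c / b)) *
      ((q - p) / (γ - p)) * (c / b) = critParamArgmax p q γ a c ^ (γ - q) := by
    rw [← neg_sub γ q, Real.rpow_neg hT.le]
    field_simp
  rw [hpow, ← Real.rpow_mul hT.le, mul_one_div_cancel h1.ne', Real.rpow_one]

end

theorem stmt16 (p q γ a b c : ℝ)
    (hp : 1 < p) (hpq : p < q) (hqγ : q < γ)
    (ha : 0 < a) (hb : 0 < b) (hc : 0 < c)
    (tm tp : ℝ → ℝ)
    (htzeros : ∀ lam : ℝ, 0 < lam → lam < lamCrit p q γ a b c →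
      0 < tm lam ∧ tm lam < tp lam ∧
      deriv (phiF p q γ a b c lam) (tm lam) = 0 ∧
      deriv (phiF p q γ a b c lam) (tp lam) = 0 ∧
      (∀ t : ℝ, 0 < t → deriv (phiF p q γ a b c lam) t = 0 →
        t = tm lam ∨ t = tp lam)) :
    StrictAntiOn tp (Set.Ioo 0 (lamCrit p q γ a b c)) ∧
    ContinuousOn tp (Set.Ioo 0 (lamCrit p q γ a b c)) ∧
    StrictMonoOn tm (Set.Ioo 0 (lamCrit p q γ a b c)) ∧
    ContinuousOn tm (Set.Ioo 0 (lamCrit p q γ a b c)) ∧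
    Filter.Tendsto tp (nhdsWithin (lamCrit p q γ a b c) (Set.Iio (lamCrit p q γ a b c)))
      (nhds (tCrit p q γ a b c)) ∧
    Filter.Tendsto tm (nhdsWithin (lamCrit p q γ a b c) (Set.Iio (lamCrit p q γ a b c)))
      (nhds (tCrit p q γ a b c)) := by
  have hmono := strictMonoOn_critParam hpq hqγ ha hb hc
  have hanti := strictAntiOn_critParam hpq hqγ ha hb hc
  have hmax := critParam_argmax hpq hqγ ha hb hc
  have hT := critParamArgmax_pos hpq hqγ ha hc
  rw [tCrit_eq_critParamArgmax hpq hqγ ha hb hc]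
  have hL := lamCrit_pos hpq hqγ ha hb hc
  set L := lamCrit p q γ a b c
  set T := critParamArgmax p q γ a c
  have hq : 0 < q := by linarith
  have hm : ∀ y ∈ Ioo 0 L, critParam p q γ a b c (tm y) = y := fun y hy =>
    have h := htzeros y hy.1 hy.2
    critParam_eq_of_deriv_eq_zero (by linarith) hq (by linarith) hb h.1 h.2.2.1
  have hpl : ∀ y ∈ Ioo 0 L, critParam p q γ a b c (tp y) = y := fun y hy =>
    have h := htzeros y hy.1 hy.2
    critParam_eq_of_deriv_eq_zero (by linarith) hq (by linarith) hb (h.1.trans h.2.1) h.2.2.2.1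
  have hmT : MapsTo tm (Ioo 0 L) (Ioc 0 T) := by
    intro y hy
    obtain ⟨h0, hlt, -⟩ := htzeros y hy.1 hy.2
    refine ⟨h0, le_of_not_gt fun hgt => ?_⟩
    have := hanti hgt.le (hgt.trans hlt).le hlt
    rw [hm y hy, hpl y hy] at this
    exact this.false
  have hpT : MapsTo tp (Ioo 0 L) (Ici T) := by
    intro y hy
    obtain ⟨h0, hlt, -⟩ := htzeros y hy.1 hy.2
    refine le_of_not_gt fun (hgt : tp y < T) => ?_
    have := hmono ⟨h0, (hlt.trans hgt).le⟩ ⟨h0.trans hlt, hgt.le⟩ hlt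
    rw [hm y hy, hpl y hy] at this
    exact this.false
  have hmlim {x : ℝ} (hx : x ∈ Ioc 0 T) :=
    hmono.tendsto_rightInverse ordConnected_Ioc hmT hm hx
  have hplim {x : ℝ} (hx : x ∈ Ici T) :=
    hanti.tendsto_rightInverse ordConnected_Ici hpT hpl hx
  refine ⟨fun x hx y hy hxy => ?_, fun y hy => ?_, fun x hx y hy hxy => ?_, fun y hy => ?_,
    ?_, ?_⟩
  · rwa [← hanti.lt_iff_gt (hpT hx) (hpT hy), hpl x hx, hpl y hy]
  · simpa only [ContinuousWithinAt, hpl y hy] using hplim (hpT hy)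
  · rwa [← hmono.lt_iff_lt (hmT hx) (hmT hy), hm x hx, hm y hy]
  · simpa only [ContinuousWithinAt, hm y hy] using hmlim (hmT hy)
  all_goals rw [← nhdsWithin_Ioo_eq_nhdsLT hL]
  · simpa only [hmax] using hplim self_mem_Ici
  · simpa only [hmax] using hmlim ⟨hT, le_rfl⟩
end

section
/- Assume (H), (E1) and (E2). If λ > 0 and u ∈ N⁰_λ, then Φ_λ(u) = ((γ−p)(q−p)/(pqγ)) · 𝒫(u); in particular Φ_λ(u) ≥ ((γ−p)(q−p)/(pqγ)) · C₁ · (C₁/C₂)^{p/(q−p)}. -/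
open Filter Topology Set

/-- If `c ≤ x ^ r` with `r` positive, then `c ^ (p / r) ≤ x ^ p`. -/
theorem rpow_div_le_rpow_of_le_rpow {c x p r : ℝ} (hc : 0 ≤ c) (hx : 0 ≤ x) (hp : 0 ≤ p)
    (hr : 0 < r) (h : c ≤ x ^ r) : c ^ (p / r) ≤ x ^ p := by
  calc c ^ (p / r) ≤ (x ^ r) ^ (p / r) := Real.rpow_le_rpow hc h (by positivity)
    _ = x ^ p := by rw [← Real.rpow_mul hx, mul_div_cancel₀ _ hr.ne']

theorem stmt17
    {X : Type*} [NormedAddCommGroup X] [NormedSpace ℝ X] [CompleteSpace X]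
    (hrefl : Function.Surjective ⇑(NormedSpace.inclusionInDoubleDual ℝ X))
    (p q γ : ℝ) (hp : 1 < p) (hpq : p < q) (hqγ : q < γ)
    (P T Q : X → ℝ)
    (hPd : ContDiff ℝ 1 P) (hTd : ContDiff ℝ 1 T) (hQd : ContDiff ℝ 1 Q)
    (hH : ∀ t : ℝ, 0 < t → ∀ u : X,
      P (t • u) = t ^ p * P u ∧ T (t • u) = t ^ γ * T u ∧ Q (t • u) = t ^ q * Q u)
    (hE1 : ∀ u : X, u ≠ 0 → 0 < P u ∧ 0 < T u ∧ 0 < Q u)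
    (C₁ C₂ : ℝ) (hC₁ : 0 < C₁) (hC₂ : 0 < C₂)
    (hE2 : ∀ u : X, C₁ * ‖u‖ ^ p ≤ P u ∧ Q u ≤ C₂ * ‖u‖ ^ q)
 :
    ∀ lam : ℝ, 0 < lam → ∀ u : X, u ≠ 0 → P u + lam * T u = Q u →
      p * P u + lam * γ * T u - q * Q u = 0 →
      Phi p q γ lam P T Q u = ((γ - p) * (q - p) / (p * q * γ)) * P u ∧
      ((γ - p) * (q - p) / (p * q * γ)) * C₁ * (C₁ / C₂) ^ (p / (q - p)) ≤ Phi p q γ lam P T Q u := by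
  intro lam hlam u hu hN hdeg
  have hp0 : 0 < p := by linarith
  have hq0 : 0 < q := by linarith
  have hγ0 : 0 < γ := by linarith
  have heq : Phi p q γ lam P T Q u = ((γ - p) * (q - p) / (p * q * γ)) * P u := by
    unfold Phi
    rw [← hN] at hdeg ⊢
    field_simp
    linear_combination -p * hdeg
  refine ⟨heq, ?_⟩
  have hu0 : 0 < ‖u‖ := norm_pos_iff.mpr hu
  have hnorm : C₁ / C₂ ≤ ‖u‖ ^ (q - p) := by
    rw [Real.rpow_sub hu0, div_le_div_iff₀ hC₂ (by positivity)]
    linarith [hE2 u, mul_pos hlam (hE1 u hu).2.1]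
  have hpow : (C₁ / C₂) ^ (p / (q - p)) ≤ ‖u‖ ^ p :=
    rpow_div_le_rpow_of_le_rpow (by positivity) hu0.le hp0.le (sub_pos.mpr hpq) hnorm
  have hK : 0 ≤ (γ - p) * (q - p) / (p * q * γ) :=
    div_nonneg (mul_nonneg (by linarith) (by linarith)) (by positivity)
  rw [heq, mul_assoc]
  exact mul_le_mul_of_nonneg_left
    ((mul_le_mul_of_nonneg_left hpow hC₁.le).trans (hE2 u).1) hK
end

section
/- Assume (H), (E1), and additionally 𝒯(u) = 𝒫(u)^{γ/p} for all u ∈ X. Then for every λ > 0: if u ∈ N⁰_λ then 𝒫(u)^{(γ−p)/p} = (q−p)/((γ−q)λ) and Φ_λ(u) = ((γ−p)/(pqγ)) · (q−p)^{γ/(γ−p)} · (γ−q)^{−p/(γ−p)} · λ^{−p/(γ−p)}. Moreover 𝒫(u)^{(γ−p)/p} < (q−p)/((γ−q)λ) for every u ∈ N⁻_λ, and 𝒫(u)^{(γ−p)/p} > (q−p)/((γ−q)λ) for every u ∈ N⁺_λ. -/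
open Filter Topology Set

theorem stmt18
    {X : Type*} [NormedAddCommGroup X] [NormedSpace ℝ X] [CompleteSpace X]
    (hrefl : Function.Surjective ⇑(NormedSpace.inclusionInDoubleDual ℝ X))
    (p q γ : ℝ) (hp : 1 < p) (hpq : p < q) (hqγ : q < γ)
    (P T Q : X → ℝ)
    (hPd : ContDiff ℝ 1 P) (hTd : ContDiff ℝ 1 T) (hQd : ContDiff ℝ 1 Q)
    (hH : ∀ t : ℝ, 0 < t → ∀ u : X,
      P (t • u) = t ^ p * P u ∧ T (t • u) = t ^ γ * T u ∧ Q (t • u) = t ^ q * Q u)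
    (hE1 : ∀ u : X, u ≠ 0 → 0 < P u ∧ 0 < T u ∧ 0 < Q u)
    (hT : ∀ u : X, T u = P u ^ (γ / p)) :
    ∀ lam : ℝ, 0 < lam →
      (∀ u : X, u ≠ 0 → P u + lam * T u = Q u →
        p * P u + lam * γ * T u - q * Q u = 0 →
        P u ^ ((γ - p) / p) = (q - p) / ((γ - q) * lam) ∧
        Phi p q γ lam P T Q u = ((γ - p) / (p * q * γ)) * (q - p) ^ (γ / (γ - p)) *
          (γ - q) ^ (-(p / (γ - p))) * lam ^ (-(p / (γ - p)))) ∧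
      (∀ u : X, u ≠ 0 → P u + lam * T u = Q u →
        p * P u + lam * γ * T u - q * Q u < 0 →
        P u ^ ((γ - p) / p) < (q - p) / ((γ - q) * lam)) ∧
      (∀ u : X, u ≠ 0 → P u + lam * T u = Q u →
        0 < p * P u + lam * γ * T u - q * Q u →
        (q - p) / ((γ - q) * lam) < P u ^ ((γ - p) / p)) := by
  intro lam hlam
  have hγq : 0 < γ - q := sub_pos.mpr hqγ
  have hqp : 0 < q - p := sub_pos.mpr hpq
  have hγp : 0 < γ - p := by linarith
  have hp0 : 0 < p := by linarith
  have hq0 : 0 < q := by linarith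
  have hγ0 : 0 < γ := by linarith
  have hc : 0 < (γ - q) * lam := mul_pos hγq hlam
  have hTP (u : X) (hu : u ≠ 0) : T u = P u * P u ^ ((γ - p) / p) := by
    rw [hT u, show γ / p = 1 + (γ - p) / p by field_simp; ring,
      Real.rpow_add (hE1 u hu).1, Real.rpow_one]
  have hsecond (u : X) (hu : u ≠ 0) (hN : P u + lam * T u = Q u) :
      p * P u + lam * γ * T u - q * Q u =
        P u * (P u ^ ((γ - p) / p) * ((γ - q) * lam) - (q - p)) := by
    rw [← hN, hTP u hu]
    ring
  refine ⟨fun u hu hN h0 => ?_, fun u hu hN hneg => ?_, fun u hu hN hpos => ?_⟩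
  · have hP := (hE1 u hu).1
    rw [hsecond u hu hN, mul_eq_zero, or_iff_right hP.ne', sub_eq_zero] at h0
    have hs : P u ^ ((γ - p) / p) = (q - p) / ((γ - q) * lam) :=
      (eq_div_iff hc.ne').mpr h0
    refine ⟨hs, ?_⟩
    have hPu : P u = (q - p) ^ (p / (γ - p)) * (γ - q) ^ (-(p / (γ - p))) *
        lam ^ (-(p / (γ - p))) := by
      calc P u = (P u ^ ((γ - p) / p)) ^ (p / (γ - p)) := by
            rw [← Real.rpow_mul hP.le, show (γ - p) / p * (p / (γ - p)) = 1 by field_simp,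
              Real.rpow_one]
        _ = _ := by
            rw [hs, Real.div_rpow hqp.le hc.le, Real.mul_rpow hγq.le hlam.le,
              Real.rpow_neg hγq.le, Real.rpow_neg hlam.le, div_eq_mul_inv, mul_inv, mul_assoc]
    have hΦ : Phi p q γ lam P T Q u = (γ - p) / (p * q * γ) * (q - p) * P u := by
      rw [Phi, ← hN, hTP u hu, hs]
      field_simp
      ring
    rw [hΦ, hPu, show γ / (γ - p) = 1 + p / (γ - p) by field_simp; ring,
      Real.rpow_add hqp, Real.rpow_one]
    ring
  · rw [hsecond u hu hN] at hneg
    rw [lt_div_iff₀ hc]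
    exact sub_neg.mp (neg_of_mul_neg_right hneg (hE1 u hu).1.le)
  · rw [hsecond u hu hN] at hpos
    rw [div_lt_iff₀ hc]
    exact sub_pos.mp (pos_of_mul_pos_right hpos (hE1 u hu).1.le)
end

section
/- Assume (H), (E1), (E3), and additionally 𝒯(u) = 𝒫(u)^{γ/p} for all u ∈ X. Then for every λ ∈ (0, λ*) and every u ∈ N⁻_λ one has Φ_λ(u) < ((γ−p)/(pqγ)) · (q−p)^{γ/(γ−p)} · (γ−q)^{−p/(γ−p)} · λ^{−p/(γ−p)}. -/
open Filter Topology Set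

/-- The function `x ↦ (q - p) / (p * q) * x - lam * (γ - q) / (γ * q) * x ^ (γ / p)` stays strictly
below its value at the critical point `x₀`, characterised by
`(γ - q) * lam * x₀ ^ (γ / p) = (q - p) * x₀`. -/
theorem fiber_energy_lt {p q γ lam x x₀ : ℝ} (hp : 0 < p) (hpq : p < q) (hqγ : q < γ)
    (hx : 0 ≤ x) (hx₀ : 0 < x₀) (hne : x ≠ x₀)
    (hcrit : (γ - q) * (lam * x₀ ^ (γ / p)) = (q - p) * x₀) :
    (1 / p) * x + (lam / γ) * x ^ (γ / p) - (1 / q) * (x + lam * x ^ (γ / p)) <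
      (γ - p) / (p * q * γ) * ((q - p) * x₀) := by
  have hq : 0 < q := hp.trans hpq
  have hγ : 0 < γ := hq.trans hqγ
  have hs : 0 ≤ x / x₀ := by positivity
  have hbern := one_add_mul_self_lt_rpow_one_add (s := x / x₀ - 1) (by linarith)
    (by rw [sub_ne_zero, Ne, div_eq_one_iff_eq hx₀.ne']; exact hne)
    ((one_lt_div hp).2 (hpq.trans hqγ))
  rw [add_sub_cancel] at hbern
  have hxs : x = x / x₀ * x₀ := by field_simp
  have hpow : x ^ (γ / p) = (x / x₀) ^ (γ / p) * x₀ ^ (γ / p) := by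
    rw [← Real.mul_rpow hs hx₀.le, ← hxs]
  generalize x / x₀ = s at *
  generalize s ^ (γ / p) = S at *
  rw [hpow, hxs]
  have hlow : p + γ * (s - 1) < p * S := by
    have h := mul_lt_mul_of_pos_left hbern hp
    have e : p * (1 + γ / p * (s - 1)) = p + γ * (s - 1) := by field_simp
    linarith
  have key : (γ - p) / (p * q * γ) * ((q - p) * x₀) -
      ((1 / p) * (s * x₀) + (lam / γ) * (S * x₀ ^ (γ / p)) -
        (1 / q) * (s * x₀ + lam * (S * x₀ ^ (γ / p)))) =
      (q - p) * x₀ * (p * S - (p + γ * (s - 1))) / (p * q * γ) := by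
    field_simp
    linear_combination p * S * hcrit
  have hpos : 0 < (q - p) * x₀ * (p * S - (p + γ * (s - 1))) / (p * q * γ) :=
    div_pos (mul_pos (mul_pos (sub_pos.2 hpq) hx₀) (sub_pos.2 hlow)) (by positivity)
  linarith

theorem stmt19
    {X : Type*} [NormedAddCommGroup X] [NormedSpace ℝ X] [CompleteSpace X]
    (hrefl : Function.Surjective ⇑(NormedSpace.inclusionInDoubleDual ℝ X))
    (p q γ : ℝ) (hp : 1 < p) (hpq : p < q) (hqγ : q < γ)
    (P T Q : X → ℝ)
    (hPd : ContDiff ℝ 1 P) (hTd : ContDiff ℝ 1 T) (hQd : ContDiff ℝ 1 Q)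
    (hH : ∀ t : ℝ, 0 < t → ∀ u : X,
      P (t • u) = t ^ p * P u ∧ T (t • u) = t ^ γ * T u ∧ Q (t • u) = t ^ q * Q u)
    (hE1 : ∀ u : X, u ≠ 0 → 0 < P u ∧ 0 < T u ∧ 0 < Q u)
    (hE3 : ∃ C : ℝ, 0 < C ∧ ∀ u : X, u ≠ 0 →
      Q u ^ ((γ - p) / (q - p)) ≤ C * (T u * P u ^ ((γ - q) / (q - p))))
    (hT : ∀ u : X, T u = P u ^ (γ / p)) :
    ∀ lam : ℝ, 0 < lam → lam < lamStar p q γ P T Q →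
      ∀ u : X, u ≠ 0 → P u + lam * T u = Q u →
        p * P u + lam * γ * T u - q * Q u < 0 →
        Phi p q γ lam P T Q u < ((γ - p) / (p * q * γ)) * (q - p) ^ (γ / (γ - p)) *
          (γ - q) ^ (-(p / (γ - p))) * lam ^ (-(p / (γ - p))) := by
  intro lam hlam _ u hu hN hNminus
  have hp0 : 0 < p := one_pos.trans hp
  have hqp : 0 < q - p := sub_pos.2 hpq
  have hγq : 0 < γ - q := sub_pos.2 hqγ
  have hγp : 0 < γ - p := by linarith
  have ha : 0 < P u := (hE1 u hu).1
  have hc : 0 < (q - p) / ((γ - q) * lam) := by positivity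
  obtain ⟨x₀, hx₀⟩ : ∃ x₀, x₀ = ((q - p) / ((γ - q) * lam)) ^ (p / (γ - p)) := ⟨_, rfl⟩
  have hx₀pos : 0 < x₀ := hx₀ ▸ Real.rpow_pos_of_pos hc _
  have hcrit : (γ - q) * (lam * x₀ ^ (γ / p)) = (q - p) * x₀ := by
    have hsplit : x₀ ^ (γ / p) = (q - p) / ((γ - q) * lam) * x₀ := by
      have e : p / (γ - p) * (γ / p) = 1 + p / (γ - p) := by field_simp; ring
      rw [hx₀, ← Real.rpow_mul hc.le, e, Real.rpow_add hc, Real.rpow_one]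
    rw [hsplit]
    field_simp
  have hval : (q - p) ^ (γ / (γ - p)) * (γ - q) ^ (-(p / (γ - p))) * lam ^ (-(p / (γ - p))) =
      (q - p) * x₀ := by
    have e : γ / (γ - p) = 1 + p / (γ - p) := by field_simp; ring
    rw [hx₀, Real.div_rpow hqp.le (by positivity), Real.mul_rpow hγq.le hlam.le, e,
      Real.rpow_add hqp, Real.rpow_one, Real.rpow_neg hγq.le, Real.rpow_neg hlam.le]
    field_simp
  rw [hT] at hN hNminus
  have hne : P u ≠ x₀ := by
    rintro h
    rw [← hN, h] at hNminus
    nlinarith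
  have hmain := fiber_energy_lt hp0 hpq hqγ ha.le hx₀pos hne hcrit
  rw [hN] at hmain
  rw [Phi, hT, mul_assoc ((γ - p) / (p * q * γ)), mul_assoc ((γ - p) / (p * q * γ)), hval]
  exact hmain
end
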